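/- Let G be a finitely generated, non-elementary group and let X be a quasi-convex G-space with basepoint o. If some element of G is strongly contracting for the action of G on X, then the action of G on X is a growth tight action: δ_{G/Γ} < δ_G for every infinite normal subgroup Γ of G. -/

import Mathlib

open Filter Metric
open scoped ENNReal

section Defs

variable {G : Type*} {X : Type*} [Group G] [MetricSpace X] [MulAction G X]

/-- A geodesic from `x` to `y`: an isometric parameterization of `[0, dist x y]`. -/
def GeodesicFromTo (γ : ℝ → X) (x y : X) : Prop :=
  γ 0 = x ∧ γ (dist x y) = y ∧
    ∀ s ∈ Set.Icc (0 : ℝ) (dist x y), ∀ t ∈ Set.Icc (0 : ℝ) (dist x y),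
      dist (γ s) (γ t) = |s - t|

/-- A geodesic metric space. -/
def GeodesicSpace (X : Type*) [MetricSpace X] : Prop :=
  ∀ x y : X, ∃ γ : ℝ → X, GeodesicFromTo γ x y

/-- The action of `G` on `X` is by isometries. -/
def IsometricAction (G X : Type*) [Group G] [MetricSpace X] [MulAction G X] : Prop :=
  ∀ (g : G) (x y : X), dist (g • x) (g • y) = dist x y

/-- The action of `G` on `X` is properly discontinuous. -/
def ProperlyDiscontinuousAction (G X : Type*) [Group G] [MetricSpace X] [MulAction G X] : Prop :=
  ∀ K : Set X, IsCompact K → {g : G | ((g • ·) '' K ∩ K).Nonempty}.Finite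

/-- `G` is non-elementary: no cyclic subgroup has finite index. -/
def NonElementary (G : Type*) [Group G] : Prop :=
  ∀ g : G, (Subgroup.zpowers g).index = 0

/-- Growth exponent of a subset `A ⊆ G`, with respect to basepoint `o`. -/
noncomputable def growthExp (o : X) (A : Set G) : ℝ≥0∞ :=
  Filter.limsup (fun r : ℝ =>
    ENNReal.ofReal (Real.log (Nat.card {g : G // g ∈ A ∧ dist o (g • o) ≤ r}) / r))
    Filter.atTop

/-- Growth exponent of the quotient `G ⧸ Γ` with the induced pseudo-metric. -/
noncomputable def quotGrowthExp (o : X) (Γ : Subgroup G) : ℝ≥0∞ :=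
  Filter.limsup (fun r : ℝ =>
    ENNReal.ofReal (Real.log (Nat.card
      {q : G ⧸ Γ // ∃ g : G, QuotientGroup.mk g = q ∧ (⨅ γ : Γ, dist o ((g * γ) • o)) ≤ r}) / r))
    Filter.atTop

/-- A growth tight action. -/
def GrowthTight (G : Type*) [Group G] {X : Type*} [MetricSpace X] [MulAction G X] (o : X) : Prop :=
  ∀ Γ : Subgroup G, Γ.Normal → (Γ : Set G).Infinite →
    quotGrowthExp o Γ < growthExp o (Set.univ : Set G)

/-- The `⟨h⟩`-orbit of the basepoint. -/
def zOrbit (o : X) (h : G) : Set X := Set.range fun i : ℤ => h ^ i • o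

/-- Nearest point projection to a subset. -/
def nprojSet (S : Set X) (x : X) : Set X := {a ∈ S | dist x a = Metric.infDist x S}

/-- `h` is a strongly contracting element for `G ↷ X`. -/
def StronglyContractingElem (o : X) (h : G) : Prop :=
  ¬ IsOfFinOrder h ∧
  (∃ M C : ℝ, 1 ≤ M ∧ 0 ≤ C ∧ ∀ i j : ℤ,
    (1 / M) * |(i : ℝ) - (j : ℝ)| - C ≤ dist (h ^ i • o) (h ^ j • o) ∧
    dist (h ^ i • o) (h ^ j • o) ≤ M * |(i : ℝ) - (j : ℝ)| + C) ∧
  (∃ C : ℝ, 0 ≤ C ∧ ∀ x y : X,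
    dist x y < Metric.infDist x (zOrbit o h) - C →
    Metric.diam (nprojSet (zOrbit o h) x ∪ nprojSet (zOrbit o h) y) ≤ C)

def QuasiConvexGSpace (G : Type*) [Group G] {X : Type*} [MetricSpace X] [MulAction G X]
    (o : X) : Prop :=
  ∃ C : ℝ, 0 ≤ C ∧ ∀ g g' : G, ∃ γ : ℝ → X, GeodesicFromTo γ (g • o) (g' • o) ∧
    ∀ t ∈ Set.Icc (0 : ℝ) (dist (g • o) (g' • o)),
      Metric.infDist (γ t) (Set.range fun g'' : G => g'' • o) ≤ C


end Defs


section ContractingProjection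

variable {X : Type*} [MetricSpace X]

/-- A nearest-point projection `p` onto `A` for which geodesics with distant projections
essentially pass through the two projection points. -/
structure IsContractingProj (p : X → X) (A : Set X) (c : ℝ) : Prop where
  nonneg : 0 ≤ c
  mem : ∀ x, p x ∈ A
  nearest : ∀ x, ∀ a ∈ A, dist x (p x) ≤ dist x a
  additive : ∀ x y, c < dist (p x) (p y) →
    dist x (p x) + dist (p x) (p y) + dist (p y) y ≤ dist x y + c

theorem dist_proj_le_of_far_steps {p : X → X} {C : ℝ} (hC : 1 ≤ C)
    (hcon : ∀ x y, dist x y < dist x (p x) - C → dist (p x) (p y) ≤ C)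
    {γ : ℝ → X} {T : ℝ}
    (hγ : ∀ s ∈ Set.Icc (0 : ℝ) T, ∀ t ∈ Set.Icc (0 : ℝ) T, dist (γ s) (γ t) = |s - t|)
    {t : ℝ} (htT : t ≤ T) (n : ℕ) :
    ∀ s, 0 ≤ s → s ≤ t → t - s ≤ n * (2 * C) →
      (∀ u ∈ Set.Icc s t, 4 * C ≤ dist (γ u) (p (γ u))) →
      dist (p (γ s)) (p (γ t)) ≤ n * C := by
  induction n with
  | zero =>
    intro s _ hst hle _
    have : s = t := by simp at hle; linarith
    simp [this]
  | succ n ih =>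
    intro s hs hst hle hfar
    push_cast at hle ⊢
    have hfs := hfar s ⟨le_rfl, hst⟩
    rcases le_total (t - s) (2 * C) with hsmall | hbig
    · have hd := hγ s ⟨hs, hst.trans htT⟩ t ⟨hs.trans hst, htT⟩
      rw [abs_sub_comm, abs_of_nonneg (by linarith)] at hd
      have := hcon (γ s) (γ t) (by linarith)
      have : 0 ≤ (n : ℝ) * C := by positivity
      linarith
    · have hd := hγ s ⟨hs, hst.trans htT⟩ (s + 2 * C) ⟨by linarith, by linarith⟩
      rw [abs_sub_comm, abs_of_nonneg (by linarith)] at hd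
      have h1 := hcon (γ s) (γ (s + 2 * C)) (by linarith)
      have h2 := ih (s + 2 * C) (by linarith) (by linarith) (by linarith)
        fun u hu => hfar u ⟨by linarith [hu.1], hu.2⟩
      linarith [dist_triangle (p (γ s)) (p (γ (s + 2 * C))) (p (γ t))]

theorem dist_proj_le_of_far {p : X → X} {C : ℝ} (hC : 1 ≤ C)
    (hcon : ∀ x y, dist x y < dist x (p x) - C → dist (p x) (p y) ≤ C)
    {γ : ℝ → X} {T : ℝ}
    (hγ : ∀ s ∈ Set.Icc (0 : ℝ) T, ∀ t ∈ Set.Icc (0 : ℝ) T, dist (γ s) (γ t) = |s - t|)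
    {t : ℝ} (ht : 0 ≤ t) (htT : t ≤ T)
    (hfar : ∀ u ∈ Set.Icc 0 t, 4 * C ≤ dist (γ u) (p (γ u))) :
    dist (p (γ 0)) (p (γ t)) ≤ 10 * C := by
  set a := dist (γ 0) (p (γ 0)) with ha
  set b := dist (γ t) (p (γ t)) with hb
  have ha4 : 4 * C ≤ a := hfar 0 ⟨le_rfl, ht⟩
  have hb4 : 4 * C ≤ b := hfar t ⟨ht, le_rfl⟩
  have hd : ∀ s ∈ Set.Icc 0 t, ∀ u ∈ Set.Icc 0 t, s ≤ u → dist (γ s) (γ u) = u - s := by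
    intro s hs u hu hsu
    rw [hγ s ⟨hs.1, hs.2.trans htT⟩ u ⟨hu.1, hu.2.trans htT⟩, abs_sub_comm,
      abs_of_nonneg (by linarith)]
  have hfromleft : ∀ u ∈ Set.Icc 0 t, u ≤ a - 2 * C → dist (p (γ 0)) (p (γ u)) ≤ C := by
    intro u hu hua
    apply hcon
    rw [hd 0 ⟨le_rfl, ht⟩ u hu hu.1]
    linarith
  have hfromright : ∀ u ∈ Set.Icc 0 t, t - u ≤ b - 2 * C → dist (p (γ t)) (p (γ u)) ≤ C := by
    intro u hu hub
    apply hcon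
    rw [dist_comm, hd u hu t ⟨ht, le_rfl⟩ hu.2]
    linarith
  rcases le_or_gt t (a - 2 * C) with h1 | h1
  · linarith [hfromleft t ⟨ht, le_rfl⟩ h1]
  rcases le_or_gt (t - (a - 2 * C)) (b - 2 * C) with h2 | h2
  · have hu : a - 2 * C ∈ Set.Icc 0 t := ⟨by linarith, h1.le⟩
    have h3 := hfromleft _ hu le_rfl
    have h4 := hfromright _ hu h2
    linarith [dist_triangle_right (p (γ 0)) (p (γ t)) (p (γ (a - 2 * C)))]
  · have hu : a - 2 * C ∈ Set.Icc 0 t := ⟨by linarith, h1.le⟩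
    have hv : t - (b - 2 * C) ∈ Set.Icc 0 t := ⟨by linarith, by linarith⟩
    have h3 := hfromleft _ hu le_rfl
    have h4 := hfromright _ hv (by linarith)
    set m := (t - (b - 2 * C) - (a - 2 * C)) / (2 * C) with hm
    have hmul : m * (2 * C) = t - (b - 2 * C) - (a - 2 * C) := by
      rw [hm]; field_simp
    have hm0 : 0 ≤ m := by rw [hm]; apply div_nonneg <;> linarith
    have h5 := dist_proj_le_of_far_steps hC hcon hγ (t := t - (b - 2 * C)) (by linarith)
      ⌈m⌉₊ (a - 2 * C) hu.1 (by linarith)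
      (by rw [← hmul]; exact mul_le_mul_of_nonneg_right (Nat.le_ceil m) (by linarith))
      fun u hu' => hfar u ⟨hu.1.trans hu'.1, hu'.2.trans hv.2⟩
    have h6 : (⌈m⌉₊ : ℝ) * C ≤ (m + 1) * C :=
      mul_le_mul_of_nonneg_right (Nat.ceil_lt_add_one hm0).le (by linarith)
    have h7 := hd 0 ⟨le_rfl, ht⟩ t ⟨ht, le_rfl⟩ ht
    have h8 := dist_triangle4 (γ 0) (p (γ 0)) (p (γ t)) (γ t)
    rw [dist_comm (p (γ t)) (γ t)] at h8
    have h9 := dist_triangle4 (p (γ 0)) (p (γ (a - 2 * C))) (p (γ (t - (b - 2 * C)))) (p (γ t))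
    rw [dist_comm (p (γ (t - (b - 2 * C)))) (p (γ t))] at h9
    linarith

theorem dist_add_dist_proj_le {p : X → X} {A : Set X} {C : ℝ} (hC : 1 ≤ C)
    (hgeo : GeodesicSpace X)
    (hmem : ∀ x, p x ∈ A) (hnear : ∀ x, ∀ a ∈ A, dist x (p x) ≤ dist x a)
    (hcon : ∀ x y, dist x y < dist x (p x) - C → dist (p x) (p y) ≤ C)
    (x y : X) (hxy : 10 * C < dist (p x) (p y)) :
    dist x (p x) + dist (p x) y ≤ dist x y + 30 * C := by
  obtain ⟨γ, h0, h1, hγ⟩ := hgeo x y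
  set T := dist x y with hT
  have hT0 : 0 ≤ T := dist_nonneg
  have hlip : ∀ x y, dist x (p x) ≤ dist x y + dist y (p y) := fun x y =>
    (hnear x _ (hmem y)).trans (dist_triangle _ _ _)
  set S : Set ℝ := {t ∈ Set.Icc 0 T | dist (γ t) (p (γ t)) ≤ 5 * C} with hS
  have hne : S.Nonempty := by
    by_contra hemp
    rw [Set.not_nonempty_iff_eq_empty] at hemp
    have := dist_proj_le_of_far hC hcon hγ hT0 le_rfl fun u hu => by
      by_contra hlt
      have : u ∈ S := ⟨hu, by linarith⟩
      simp [hemp] at this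
    rw [h0, h1] at this
    linarith
  have hbdd : BddBelow S := ⟨0, fun t ht => ht.1.1⟩
  obtain ⟨u, huS, hu⟩ : ∃ u ∈ S, ∀ t ∈ S, u - C < t := by
    obtain ⟨u, huS, hu⟩ := exists_lt_of_csInf_lt hne (show sInf S < sInf S + C by linarith)
    exact ⟨u, huS, fun t ht => by linarith [csInf_le hbdd ht]⟩
  have hd : ∀ s t, 0 ≤ s → s ≤ t → t ≤ T → dist (γ s) (γ t) = t - s := by
    intro s t h0s hst htT
    rw [hγ s ⟨h0s, hst.trans htT⟩ t ⟨h0s.trans hst, htT⟩, abs_sub_comm,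
      abs_of_nonneg (by linarith)]
  have hclose : dist (p x) (γ u) ≤ 15 * C := by
    by_cases huC : u < C
    · have h2 := hd 0 u le_rfl huS.1.1 huS.1.2
      have h3 := hlip (γ 0) (γ u)
      have h4 := dist_triangle (p x) (γ 0) (γ u)
      rw [h0] at h2 h3 h4
      rw [dist_comm (p x) x] at h4
      linarith [huS.2]
    · push Not at huC
      have h2 := dist_proj_le_of_far hC hcon hγ huS.1.1 huS.1.2 fun t ht => by
        by_contra hlt
        push Not at hlt
        rcases le_or_gt C t with htC | htC
        · have h3 := hd (t - C) t (by linarith) (by linarith) (ht.2.trans huS.1.2)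
          have h4 := hlip (γ (t - C)) (γ t)
          have : t - C ∈ S :=
            ⟨⟨by linarith, by linarith [ht.2, huS.1.2]⟩, by linarith⟩
          linarith [hu _ this, ht.2]
        · have h3 := hd 0 t le_rfl ht.1 (ht.2.trans huS.1.2)
          have h4 := hlip (γ 0) (γ t)
          have : (0 : ℝ) ∈ S := ⟨⟨le_rfl, hT0⟩, by linarith⟩
          linarith [hu _ this, ht.2]
      rw [h0] at h2
      have := dist_triangle_right (p x) (γ u) (p (γ u))
      linarith [huS.2]
  have h5 := hd 0 u le_rfl huS.1.1 huS.1.2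
  have h6 := hd u T huS.1.1 huS.1.2 le_rfl
  rw [h0] at h5
  rw [h1] at h6
  have h7 := dist_triangle_right x (p x) (γ u)
  have h8 := dist_triangle (p x) (γ u) y
  linarith

theorem isContractingProj_of_contracting {p : X → X} {A : Set X} {C : ℝ} (hC : 1 ≤ C)
    (hgeo : GeodesicSpace X)
    (hmem : ∀ x, p x ∈ A) (hnear : ∀ x, ∀ a ∈ A, dist x (p x) ≤ dist x a)
    (hcon : ∀ x y, dist x y < dist x (p x) - C → dist (p x) (p y) ≤ C) :
    IsContractingProj p A (60 * C) where
  nonneg := by linarith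
  mem := hmem
  nearest := hnear
  additive x y hxy := by
    have h1 := dist_add_dist_proj_le hC hgeo hmem hnear hcon x y (by linarith)
    have hfix : p (p x) = p x := by
      have := hnear (p x) _ (hmem x)
      rw [dist_self] at this
      exact (dist_le_zero.1 this).symm
    have h2 := dist_add_dist_proj_le hC hgeo hmem hnear hcon y (p x)
      (by rw [hfix, dist_comm]; linarith)
    rw [dist_comm y (p y), dist_comm (p y) (p x), dist_comm y (p x)] at h2
    linarith

namespace IsContractingProj

variable {p q : X → X} {A B : Set X} {c : ℝ}

theorem apply_of_mem (hp : IsContractingProj p A c) {a : X} (ha : a ∈ A) : p a = a := by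
  have := hp.nearest a a ha
  rw [dist_self] at this
  exact (dist_le_zero.1 this).symm

theorem dist_proj_le (hp : IsContractingProj p A c) (x y : X) :
    dist (p x) (p y) ≤ dist x y + c := by
  rcases le_or_gt (dist (p x) (p y)) c with h | h
  · linarith [dist_nonneg (x := x) (y := y)]
  · linarith [hp.additive x y h, dist_nonneg (x := x) (y := p x), dist_nonneg (x := p y) (y := y)]

theorem dist_add_dist_le (hp : IsContractingProj p A c) {a : X} (ha : a ∈ A) (x : X) :
    dist a (p x) + dist (p x) x ≤ dist a x + c := by
  rcases le_or_gt (dist a (p x)) c with h | h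
  · have := hp.nearest x a ha
    rw [dist_comm x, dist_comm x] at this
    linarith
  · have := hp.additive a x (by rwa [hp.apply_of_mem ha])
    rw [hp.apply_of_mem ha, dist_self] at this
    linarith

theorem behrstock_proj (hp : IsContractingProj p A c) (hq : IsContractingProj q B c) (x : X) :
    dist (p x) (p (q x)) ≤ 2 * c ∨ dist (q x) (q (p x)) ≤ 2 * c := by
  have hc := hp.nonneg
  by_contra! hcon
  have h1 := hp.additive x (q x) (by linarith)
  have h2 := hq.additive x (p x) (by linarith)
  have h3 := dist_triangle (p x) (p (q x)) (q x)
  have h4 := dist_triangle (q x) (q (p x)) (p x)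
  have h5 := hq.nearest (p x) _ (hq.mem x)
  have h6 := dist_triangle (q x) (p x) (q (p x))
  rw [dist_comm (q x) (p x)] at h4 h6
  linarith [hcon.2]

theorem behrstock (hp : IsContractingProj p A c) (hq : IsContractingProj q B c) {κ : ℝ}
    (hpB : ∀ b ∈ B, ∀ b' ∈ B, dist (p b) (p b') ≤ κ)
    (hqA : ∀ a ∈ A, ∀ a' ∈ A, dist (q a) (q a') ≤ κ)
    (x : X) {a b : X} (ha : a ∈ A) (hb : b ∈ B) :
    dist (p x) (p b) ≤ 2 * c + κ ∨ dist (q x) (q a) ≤ 2 * c + κ := by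
  rcases hp.behrstock_proj hq x with h | h
  · left
    linarith [dist_triangle (p x) (p (q x)) (p b), hpB _ (hq.mem x) _ hb]
  · right
    linarith [dist_triangle (q x) (q (p x)) (q a), hqA _ (hp.mem x) _ ha]

end IsContractingProj

/-- Two sets lie in the closed `κ`-neighbourhoods of each other. -/
def HausdorffClose (κ : ℝ) (A B : Set X) : Prop :=
  (∀ a ∈ A, ∃ b ∈ B, dist a b ≤ κ) ∧ ∀ b ∈ B, ∃ a ∈ A, dist b a ≤ κ

theorem HausdorffClose.symm {κ : ℝ} {A B : Set X} (h : HausdorffClose κ A B) :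
    HausdorffClose κ B A := ⟨h.2, h.1⟩

namespace IsContractingProj

variable {p q : X → X} {A B : Set X} {c : ℝ}

theorem dist_proj_le_of_hausdorffClose (hp : IsContractingProj p A c)
    (hq : IsContractingProj q B c) {κ : ℝ} (h : HausdorffClose κ A B) (x : X) :
    dist (p x) (q x) ≤ 2 * κ + c := by
  obtain ⟨b, hb, hpb⟩ := h.1 _ (hp.mem x)
  obtain ⟨a, ha, hqa⟩ := h.2 _ (hq.mem x)
  have h1 := hp.dist_add_dist_le ha x
  have h2 := hq.dist_add_dist_le hb x
  have h3 := dist_triangle_left a x (q x)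
  have h4 := dist_triangle_left b x (p x)
  have h5 := dist_triangle_right (p x) (q x) a
  have h6 := dist_triangle_right (p x) (q x) b
  rw [dist_comm (q x) b] at h6
  rw [dist_comm (p x) a] at h5
  linarith

/-- If two points of `B` have distant projections to `A`, then points of geodesics joining the
projections are close to both `A` and `B`. -/
theorem dist_proj_proj_le_of_between (hp : IsContractingProj p A c)
    (hq : IsContractingProj q B c) {b b' : X} (hb : b ∈ B) (hb' : b' ∈ B)
    (hfar : c < dist (p b) (p b')) {w : X}
    (hw : dist (p b) w + dist w (p b') = dist (p b) (p b')) :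
    dist (p w) w ≤ c ∧ dist (q w) w ≤ 5 * c := by
  set y := p b
  set y' := p b'
  have hy : y ∈ A := hp.mem b
  have hy' : y' ∈ A := hp.mem b'
  have h1 := hp.additive b b' hfar
  have h2 := hq.dist_add_dist_le hb y
  have h3 := hq.dist_add_dist_le hb' y'
  have h4 := dist_triangle4 b (q y) (q y') b'
  have h5 := hq.dist_proj_le y y'
  have h6 := hp.dist_add_dist_le hy w
  have h7 := hp.dist_add_dist_le hy' w
  have h8 := hq.dist_add_dist_le (hq.mem y) w
  have h9 := hq.dist_add_dist_le (hq.mem y') w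
  have h10 := dist_triangle_right y y' (p w)
  have h11 := dist_triangle_right (q y) (q y') (q w)
  have h12 := dist_triangle (q y) y w
  have h13 := dist_triangle (q y') y' w
  have h14 := dist_triangle4 y (q y) (q y') y'
  rw [dist_comm w y'] at hw
  rw [dist_comm (q y') b'] at h4
  rw [dist_comm y' b'] at h1
  rw [dist_comm y (q y)] at h14
  constructor <;> linarith

end IsContractingProj

end ContractingProjection


section Axes

variable {G X : Type*} [Group G] [MulAction G X]

/-- The translate by `g` of the `⟨h⟩`-orbit of `o`. -/
def axis (o : X) (h g : G) : Set X := Set.range fun i : ℤ => (g * h ^ i) • o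

theorem zOrbit_eq_axis_one (o : X) (h : G) : zOrbit o h = axis o h 1 := by
  simp [zOrbit, axis]

theorem mem_axis_zpow (o : X) (h g : G) (i : ℤ) : (g * h ^ i) • o ∈ axis o h g := ⟨i, rfl⟩

theorem mem_axis_self (o : X) (h g : G) : g • o ∈ axis o h g := ⟨0, by simp⟩

theorem smul_mem_axis {o : X} {h g : G} {x : X} (k : G) (hx : x ∈ axis o h g) :
    k • x ∈ axis o h (k * g) := by
  obtain ⟨i, rfl⟩ := hx
  exact ⟨i, by simp [mul_smul]⟩

theorem axis_mul_zpow (o : X) (h g : G) (i : ℤ) : axis o h (g * h ^ i) = axis o h g := by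
  ext x
  constructor
  · rintro ⟨j, rfl⟩
    exact ⟨i + j, by simp [zpow_add, mul_assoc]⟩
  · rintro ⟨j, rfl⟩
    exact ⟨j - i, by simp [mul_assoc, ← zpow_add]⟩

theorem mem_axis_snd (o : X) (h γ b : G) (n : ℤ) :
    (b * h ^ n * γ) • o ∈ axis o h (b * (h ^ n * γ * h ^ (-n))) :=
  ⟨n, by group⟩

variable [MetricSpace X]

theorem finite_setOf_dist_le [ProperSpace X]
    (hPD : ProperlyDiscontinuousAction G X) (o : X) (r : ℝ) :
    {g : G | dist o (g • o) ≤ r}.Finite := by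
  rcases lt_or_ge r 0 with hr | hr
  · convert Set.finite_empty
    ext g
    simpa using hr.trans_le dist_nonneg
  · refine (hPD _ (isCompact_closedBall o r)).subset fun g hg => ?_
    refine ⟨g • o, ⟨o, mem_closedBall_self hr, rfl⟩, ?_⟩
    rw [mem_closedBall, dist_comm]
    exact hg

theorem IsometricAction.dist_smul_left (hIso : IsometricAction G X) (g : G) (x y : X) :
    dist (g • x) y = dist x (g⁻¹ • y) := by
  rw [← hIso g⁻¹, inv_smul_smul]

theorem exists_nearest_zOrbit [ProperSpace X]
    (hPD : ProperlyDiscontinuousAction G X) (o : X) (h : G) (x : X) :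
    ∃ a ∈ zOrbit o h, ∀ b ∈ zOrbit o h, dist x a ≤ dist x b := by
  have hfin : {a ∈ zOrbit o h | dist x a ≤ dist x o}.Finite := by
    refine ((finite_setOf_dist_le hPD o (2 * dist x o)).image (· • o)).subset ?_
    rintro _ ⟨⟨i, rfl⟩, hi⟩
    refine ⟨h ^ i, ?_, rfl⟩
    have := dist_triangle_left o (h ^ i • o) x
    simp only [Set.mem_ofPred_eq]
    linarith
  have hne : {a ∈ zOrbit o h | dist x a ≤ dist x o}.Nonempty := ⟨o, ⟨0, by simp⟩, le_rfl⟩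
  obtain ⟨a, ha, hmin⟩ := Set.exists_min_image _ (dist x) hfin hne
  refine ⟨a, ha.1, fun b hb => ?_⟩
  rcases le_or_gt (dist x b) (dist x o) with hbo | hbo
  · exact hmin b ⟨hb, hbo⟩
  · exact ha.2.trans hbo.le

theorem exists_isContractingProj [ProperSpace X] (hGeo : GeodesicSpace X)
    (hPD : ProperlyDiscontinuousAction G X) {o : X} {h : G}
    (hSC : StronglyContractingElem o h) :
    ∃ (p : X → X) (c : ℝ), IsContractingProj p (zOrbit o h) c := by
  obtain ⟨-, -, C, hC0, hC⟩ := hSC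
  choose p hmem hnear using exists_nearest_zOrbit hPD o h
  have hinf : ∀ x, infDist x (zOrbit o h) = dist x (p x) := fun x =>
    le_antisymm (infDist_le_dist_of_mem (hmem x))
      ((le_infDist ⟨_, hmem x⟩).2 fun b hb => hnear x b hb)
  refine ⟨p, _, isContractingProj_of_contracting (C := C + 1) (by linarith) hGeo hmem hnear
    fun x y hxy => ?_⟩
  have hbdd : ∀ z, Bornology.IsBounded (nprojSet (zOrbit o h) z) := fun z =>
    isBounded_closedBall.subset fun a ha => by
      rw [mem_closedBall, dist_comm]
      exact ha.2.le
  have := hC x y (by rw [hinf]; linarith)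
  have hle := dist_le_diam_of_mem ((hbdd x).union (hbdd y))
    (Or.inl ⟨hmem x, (hinf x).symm⟩) (Or.inr ⟨hmem y, (hinf y).symm⟩)
  linarith

theorem IsContractingProj.translate (hIso : IsometricAction G X) {o : X} {h : G} {p : X → X}
    {c : ℝ} (hp : IsContractingProj p (zOrbit o h) c) (g : G) :
    IsContractingProj (fun x => g • p (g⁻¹ • x)) (axis o h g) c where
  nonneg := hp.nonneg
  mem x := by
    have := smul_mem_axis g (zOrbit_eq_axis_one o h ▸ hp.mem (g⁻¹ • x))
    rwa [mul_one] at this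
  nearest x a ha := by
    have ha' := smul_mem_axis g⁻¹ ha
    rw [inv_mul_cancel, ← zOrbit_eq_axis_one] at ha'
    have := hp.nearest (g⁻¹ • x) _ ha'
    rwa [hIso g⁻¹, dist_comm (g⁻¹ • x), ← hIso g, smul_inv_smul, dist_comm] at this
  additive x y hxy := by
    rw [hIso] at hxy
    have := hp.additive _ _ hxy
    rw [hIso g⁻¹] at this
    rw [hIso]
    have h1 : ∀ z w, dist (g⁻¹ • z) w = dist z (g • w) := fun z w => by
      rw [hIso.dist_smul_left, inv_inv]
    rw [h1, dist_comm _ (g⁻¹ • y), h1] at this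
    rwa [dist_comm _ y]

theorem IsContractingProj.mono {p : X → X} {A : Set X} {c d : ℝ} (hp : IsContractingProj p A c)
    (hcd : c ≤ d) : IsContractingProj p A d where
  nonneg := hp.nonneg.trans hcd
  mem := hp.mem
  nearest := hp.nearest
  additive x y hxy := by linarith [hp.additive x y (hcd.trans_lt hxy)]

theorem HausdorffClose.translate (hIso : IsometricAction G X) {o : X} {h : G} {κ : ℝ} {g k : G}
    (hc : HausdorffClose κ (axis o h g) (axis o h k)) (x : G) :
    HausdorffClose κ (axis o h (x * g)) (axis o h (x * k)) := by
  have key : ∀ {g k : G}, (∀ a ∈ axis o h g, ∃ b ∈ axis o h k, dist a b ≤ κ) →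
      ∀ a ∈ axis o h (x * g), ∃ b ∈ axis o h (x * k), dist a b ≤ κ := by
    intro g k H a ha
    have ha' := smul_mem_axis x⁻¹ ha
    rw [inv_mul_cancel_left] at ha'
    obtain ⟨b, hb, hab⟩ := H _ ha'
    refine ⟨x • b, smul_mem_axis x hb, ?_⟩
    rwa [hIso.dist_smul_left, inv_inv] at hab
  exact ⟨key hc.1, key hc.2⟩

/-- If `g` conjugates a nontrivial power of `h` to a power of `h`, then the translate of the axis
by `g` stays near the axis. -/
theorem exists_dist_le_of_conj_zpow (hIso : IsometricAction G X) {o : X} {h g : G} {M C P ε : ℝ}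
    (hM : 0 ≤ M) (hup : ∀ i : ℤ, dist o (h ^ i • o) ≤ M * |(i : ℝ)| + C)
    {m n a b : ℤ} (hm : m ≠ 0) (hmP : |(m : ℝ)| ≤ P) (hconj : g * h ^ m * g⁻¹ = h ^ n)
    (hab : dist ((g * h ^ a) • o) (h ^ b • o) ≤ ε) (i : ℤ) :
    ∃ j : ℤ, dist ((g * h ^ i) • o) (h ^ j • o) ≤ ε + (M * P + C) := by
  set r := (i - a) % m
  set k := (i - a) / m
  have hi : i = m * k + (a + r) := by
    have := Int.mul_ediv_add_emod (i - a) m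
    simp only [r, k]
    linarith
  have hr : |(r : ℝ)| ≤ P := by
    refine le_trans ?_ hmP
    have h1 := Int.emod_nonneg (i - a) hm
    have h2 := Int.emod_lt_abs (i - a) hm
    rw [abs_of_nonneg (by exact_mod_cast h1)]
    exact_mod_cast h2.le
  have hconjk : g * h ^ (m * k) = h ^ (n * k) * g := by
    rw [zpow_mul, zpow_mul, ← hconj, conj_zpow]
    group
  refine ⟨n * k + b, ?_⟩
  have h1 : g * h ^ i = h ^ (n * k) * (g * h ^ (a + r)) := by
    rw [hi, zpow_add, ← mul_assoc, hconjk, mul_assoc]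
  rw [h1, zpow_add h (n * k) b, mul_smul, mul_smul (h ^ (n * k)), hIso]
  have h2 : dist ((g * h ^ (a + r)) • o) ((g * h ^ a) • o) = dist o (h ^ r • o) := by
    rw [zpow_add, ← mul_assoc, mul_smul, hIso, dist_comm]
  have h3 := dist_triangle ((g * h ^ (a + r)) • o) ((g * h ^ a) • o) (h ^ b • o)
  have h4 := hup r
  have h5 : M * |(r : ℝ)| ≤ M * P := mul_le_mul_of_nonneg_left hr hM
  linarith

theorem exists_hausdorffClose_of_far_proj [ProperSpace X] (hGeo : GeodesicSpace X)
    (hIso : IsometricAction G X) (hPD : ProperlyDiscontinuousAction G X) {o : X} {h : G}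
    (hSC : StronglyContractingElem o h) {p : X → X} {c : ℝ}
    (hp : IsContractingProj p (zOrbit o h) c) :
    ∃ κ E : ℝ, ∀ g : G, ∀ a ∈ axis o h g, ∀ a' ∈ axis o h g, E < dist (p a) (p a') →
      HausdorffClose κ (axis o h 1) (axis o h g) := by
  obtain ⟨-, ⟨M, C, hM, hC, hqi⟩, -⟩ := hSC
  have hc := hp.nonneg
  have hup : ∀ i : ℤ, dist o (h ^ i • o) ≤ M * |(i : ℝ)| + C := fun i => by
    simpa using (hqi 0 i).2
  set S := (finite_setOf_dist_le hPD o (6 * c)).toFinset with hS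
  set N : ℕ := S.card + 1 with hN
  set τ : ℝ := 12 * c + 1 with hτ
  set P : ℝ := M * (N * τ + 10 * c + C) with hP
  refine ⟨6 * c + (M * P + C), N * τ + c, fun g b hb b' hb' hfar => ?_⟩
  have hq := hp.translate hIso g
  set q : X → X := fun x => g • p (g⁻¹ • x)
  have hNτ : 0 ≤ N * τ := by positivity
  obtain ⟨σ, hσ0, hσ1, hσ⟩ := hGeo (p b) (p b')
  have hIcc : ∀ t ∈ Finset.range N, (t : ℝ) * τ ∈ Set.Icc 0 (dist (p b) (p b')) := by
    intro t ht
    refine ⟨by positivity, ?_⟩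
    have : (t : ℝ) ≤ N := by exact_mod_cast (Finset.mem_range.1 ht).le
    have : (t : ℝ) * τ ≤ N * τ := mul_le_mul_of_nonneg_right this (by positivity)
    linarith
  have hbetween : ∀ t ∈ Finset.range N,
      dist (p (σ (t * τ))) (σ (t * τ)) ≤ c ∧ dist (q (σ (t * τ))) (σ (t * τ)) ≤ 5 * c := by
    intro t ht
    refine hp.dist_proj_proj_le_of_between hq hb hb' (by linarith) ?_
    have h0 := hσ 0 ⟨le_rfl, dist_nonneg⟩ _ (hIcc t ht)
    have h1 := hσ _ (hIcc t ht) _ ⟨dist_nonneg, le_rfl⟩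
    rw [hσ0, zero_sub, abs_neg, abs_of_nonneg (hIcc t ht).1] at h0
    rw [hσ1, abs_sub_comm, abs_of_nonneg (by linarith [(hIcc t ht).2])] at h1
    rw [h0, h1]
    ring
  have hβ : ∀ x, ∃ β : ℤ, h ^ β • o = p x := fun x => hp.mem x
  have hα : ∀ x, ∃ α : ℤ, (g * h ^ α) • o = q x := fun x => hq.mem x
  choose β hβ using hβ
  choose α hα using hα
  obtain ⟨s, hs, t, ht, hst, hf⟩ := Finset.exists_ne_map_eq_of_card_lt_of_maps_to
    (s := Finset.range N) (t := S)
    (f := fun t => (h ^ β (σ (t * τ)))⁻¹ * (g * h ^ α (σ (t * τ)))) (by simp [hN]) (by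
      intro t ht
      have := hbetween t ht
      simp only [hS, Set.Finite.coe_toFinset, Set.mem_ofPred_eq]
      rw [mul_smul, ← hIso.dist_smul_left, hα, hβ]
      linarith [dist_triangle_right (p (σ (t * τ))) (q (σ (t * τ))) (σ (t * τ))])
  set x := σ (s * τ)
  set y := σ (t * τ)
  have hxy : dist x y = |(s : ℝ) - t| * τ := by
    rw [hσ _ (hIcc s hs) _ (hIcc t ht), ← sub_mul, abs_mul, abs_of_nonneg (a := τ) (by positivity)]
  have hone : (1 : ℝ) ≤ |(s : ℝ) - t| := by
    have : (1 : ℤ) ≤ |(s : ℤ) - t| := Int.one_le_abs (sub_ne_zero.2 (by exact_mod_cast hst))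
    exact_mod_cast this
  have hleN : |(s : ℝ) - t| ≤ N := by
    have h1 : (s : ℝ) ≤ N := by exact_mod_cast (Finset.mem_range.1 hs).le
    have h2 : (t : ℝ) ≤ N := by exact_mod_cast (Finset.mem_range.1 ht).le
    rw [abs_le]
    constructor <;> linarith [Nat.cast_nonneg (α := ℝ) s, Nat.cast_nonneg (α := ℝ) t]
  have hxyτ : τ ≤ dist x y := by
    rw [hxy]
    exact le_mul_of_one_le_left (by positivity) hone
  have hxyN : dist x y ≤ N * τ := by
    rw [hxy]
    exact mul_le_mul_of_nonneg_right hleN (by positivity)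
  obtain ⟨hpx, hqx⟩ := hbetween s hs
  obtain ⟨hpy, hqy⟩ := hbetween t ht
  change dist (p x) x ≤ c at hpx
  change dist (q x) x ≤ 5 * c at hqx
  change dist (p y) y ≤ c at hpy
  change dist (q y) y ≤ 5 * c at hqy
  have hαne : α y - α x ≠ 0 := by
    intro h0
    have : q x = q y := by rw [← hα, ← hα, sub_eq_zero.1 h0]
    rw [← this] at hqy
    linarith [dist_triangle_left x y (q x)]
  have hβne : β y - β x ≠ 0 := by
    intro h0
    have : p x = p y := by rw [← hβ, ← hβ, sub_eq_zero.1 h0]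
    rw [← this] at hpy
    linarith [dist_triangle_left x y (p x)]
  have hbound : ∀ i j : ℤ, dist (h ^ i • o) (h ^ j • o) ≤ N * τ + 10 * c →
      |((i - j : ℤ) : ℝ)| ≤ P := by
    intro i j hij
    have := (hqi i j).1
    have h1 : 1 / M * |(i : ℝ) - j| ≤ N * τ + 10 * c + C := by linarith
    rw [one_div, inv_mul_le_iff₀ (by linarith)] at h1
    push_cast
    exact h1
  have hαP : |((α y - α x : ℤ) : ℝ)| ≤ P := by
    apply hbound
    rw [← hIso g, ← mul_smul, ← mul_smul, hα, hα]
    have := dist_triangle4 (q y) y x (q x)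
    rw [dist_comm y x, dist_comm x (q x)] at this
    linarith
  have hβP : |((β y - β x : ℤ) : ℝ)| ≤ P := by
    apply hbound
    rw [hβ, hβ]
    have := dist_triangle4 (p y) y x (p x)
    rw [dist_comm y x, dist_comm x (p x)] at this
    linarith
  have hpq : dist (q x) (p x) ≤ 6 * c := by
    linarith [dist_triangle_right (q x) (p x) x]
  have hconj : g * h ^ (α y - α x) * g⁻¹ = h ^ (β y - β x) := by
    rw [inv_mul_eq_iff_eq_mul, ← mul_assoc, ← zpow_neg, ← zpow_add] at hf
    have h1 : g * h ^ α y = h ^ (β y - β x) * (g * h ^ α x) := by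
      rw [hf, ← mul_assoc, ← zpow_add, show β y - β x + (β x + -β y) = 0 by ring, zpow_zero,
        one_mul]
    rw [zpow_sub, ← mul_assoc, h1]
    group
  have hconj' : g⁻¹ * h ^ (β y - β x) * g⁻¹⁻¹ = h ^ (α y - α x) := by
    rw [← hconj]
    group
  constructor
  · rintro _ ⟨i, rfl⟩
    obtain ⟨j, hj⟩ := exists_dist_le_of_conj_zpow hIso (by linarith) hup hβne hβP hconj'
      (a := β x) (b := α x) (ε := 6 * c)
      (by rw [mul_smul, hIso.dist_smul_left, inv_inv, ← mul_smul, hα, hβ, dist_comm]; exact hpq) i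
    refine ⟨_, mem_axis_zpow o h g j, ?_⟩
    rw [mul_smul, hIso.dist_smul_left, inv_inv, ← mul_smul] at hj
    simpa using hj
  · rintro _ ⟨i, rfl⟩
    obtain ⟨j, hj⟩ := exists_dist_le_of_conj_zpow hIso (by linarith) hup hαne hαP hconj
      (a := α x) (b := β x) (ε := 6 * c) (by rw [hα, hβ]; exact hpq) i
    exact ⟨_, mem_axis_zpow o h 1 j, by simpa using hj⟩

/-- A family of contracting projections to the translates of an axis, such that two translates are
either Hausdorff close or have bounded projections to each other. -/
structure ContractingSystem (o : X) (h : G) (P : G → X → X) (κ₀ κ : ℝ) : Prop where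
  proj : ∀ g, IsContractingProj (P g) (axis o h g) κ
  smul : ∀ k g x, P (k * g) (k • x) = k • P g x
  dist_le_of_close : ∀ g k, HausdorffClose κ₀ (axis o h g) (axis o h k) →
    ∀ x, dist (P g x) (P k x) ≤ κ
  dist_le_of_not_close : ∀ g k, ¬ HausdorffClose κ₀ (axis o h g) (axis o h k) →
    ∀ a ∈ axis o h k, ∀ a' ∈ axis o h k, dist (P g a) (P g a') ≤ κ
  behrstock : ∀ g k, ¬ HausdorffClose κ₀ (axis o h g) (axis o h k) →
    ∀ x, ∀ a ∈ axis o h g, ∀ b ∈ axis o h k, dist (P g x) (P g b) ≤ κ ∨ dist (P k x) (P k a) ≤ κ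

theorem exists_contractingSystem [ProperSpace X] (hGeo : GeodesicSpace X)
    (hIso : IsometricAction G X) (hPD : ProperlyDiscontinuousAction G X) {o : X} {h : G}
    (hSC : StronglyContractingElem o h) :
    ∃ P κ₀ κ, ContractingSystem o h P κ₀ κ := by
  obtain ⟨p, c, hp⟩ := exists_isContractingProj hGeo hPD hSC
  obtain ⟨κ₀, E, hE⟩ := exists_hausdorffClose_of_far_proj hGeo hIso hPD hSC hp
  have hc := hp.nonneg
  set P : G → X → X := fun g x => g • p (g⁻¹ • x) with hP
  have hproj : ∀ g, IsContractingProj (P g) (axis o h g) c := fun g => hp.translate hIso g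
  have hdiam : ∀ g k, ¬ HausdorffClose κ₀ (axis o h g) (axis o h k) →
      ∀ a ∈ axis o h k, ∀ a' ∈ axis o h k, dist (P g a) (P g a') ≤ |E| := by
    intro g k hgk a ha a' ha'
    by_contra! hcon
    refine hgk ?_
    rw [hIso] at hcon
    have := (hE (g⁻¹ * k) _ (smul_mem_axis g⁻¹ ha) _ (smul_mem_axis g⁻¹ ha')
      ((le_abs_self E).trans_lt hcon)).translate hIso g
    simpa using this
  have hE0 := abs_nonneg E
  have hκ0 := abs_nonneg κ₀
  refine ⟨P, κ₀, 2 * c + 2 * |κ₀| + |E|, ?_, ?_, ?_, ?_, ?_⟩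
  · exact fun g => (hproj g).mono (by linarith)
  · intro k g x
    simp [hP, mul_smul]
  · intro g k hgk x
    have := (hproj g).dist_proj_le_of_hausdorffClose (hproj k) hgk x
    linarith [le_abs_self κ₀]
  · intro g k hgk a ha a' ha'
    linarith [hdiam g k hgk a ha a' ha']
  · intro g k hgk x a ha b hb
    rcases (hproj g).behrstock (hproj k) (hdiam g k hgk)
      (hdiam k g fun hkg => hgk hkg.symm) x ha hb with h1 | h1
    · left; linarith
    · right; linarith

end Axes


section FreeSemigroup

variable {G X : Type*} [Group G] [MetricSpace X] [MulAction G X]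

theorem exists_sub_le_dist_zpow {o : X} {h : G} (hSC : StronglyContractingElem o h) :
    ∃ M C : ℝ, 0 < M ∧ ∀ i : ℤ, M * |(i : ℝ)| - C ≤ dist o (h ^ i • o) := by
  obtain ⟨-, ⟨M, C, hM, -, hqi⟩, -⟩ := hSC
  exact ⟨1 / M, C, by positivity, fun i => by simpa using (hqi 0 i).1⟩

theorem exists_lt_dist_zpow {o : X} {h : G} (hSC : StronglyContractingElem o h) (R : ℝ) :
    ∃ N : ℕ, ∀ i : ℤ, N ≤ |i| → R < dist o (h ^ i • o) := by
  obtain ⟨M, C, hM, hMC⟩ := exists_sub_le_dist_zpow hSC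
  obtain ⟨N, hN⟩ := exists_nat_gt ((R + C) / M)
  refine ⟨N, fun i hi => ?_⟩
  rw [div_lt_iff₀ hM] at hN
  have hi' : (N : ℝ) ≤ |(i : ℝ)| := by exact_mod_cast hi
  have := mul_le_mul_of_nonneg_right hi' hM.le
  linarith [hMC i]

theorem HausdorffClose.exists_eq_zpow_mul (hIso : IsometricAction G X) {o : X} {h g : G} {κ : ℝ}
    (hc : HausdorffClose κ (axis o h 1) (axis o h g)) :
    ∃ (i : ℤ) (s : G), dist o (s • o) ≤ κ ∧ g = h ^ i * s := by
  obtain ⟨_, ⟨i, rfl⟩, hi⟩ := hc.2 _ (mem_axis_self o h g)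
  refine ⟨i, (h ^ i)⁻¹ * g, ?_, by group⟩
  rw [mul_smul, ← hIso.dist_smul_left, dist_comm]
  simpa using hi

namespace ContractingSystem

variable {o : X} {h : G} {P : G → X → X} {κ₀ κ : ℝ}

theorem exists_mem_not_hausdorffClose [ProperSpace X] (sys : ContractingSystem o h P κ₀ κ)
    (hIso : IsometricAction G X) (hPD : ProperlyDiscontinuousAction G X)
    (hSC : StronglyContractingElem o h) (hNE : NonElementary G) {Γ : Subgroup G}
    (hΓ : Γ.Normal) (hinf : (Γ : Set G).Infinite) :
    ∃ γ ∈ Γ, ¬ HausdorffClose κ₀ (axis o h 1) (axis o h γ) := by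
  by_contra! hall
  have hfin := finite_setOf_dist_le hPD o κ₀
  have hfact : ∀ γ : G, HausdorffClose κ₀ (axis o h 1) (axis o h γ) →
      ∃ (i : ℤ) (s : G), dist o (s • o) ≤ κ₀ ∧ γ = h ^ i * s := fun γ hγ =>
    hγ.exists_eq_zpow_mul hIso
  choose! i s hs hγ using hfact
  obtain ⟨γ, hγΓ, γ', hγΓ', hne, heq⟩ := hinf.exists_ne_map_eq_of_mapsTo
    (f := s) (t := {g : G | dist o (g • o) ≤ κ₀}) (fun γ hγ' => hs γ (hall γ hγ')) hfin
  set m := i γ' - i γ with hm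
  have hm0 : m ≠ 0 := by
    intro h0
    apply hne
    rw [hγ γ (hall γ hγΓ), hγ γ' (hall γ' hγΓ'), heq, sub_eq_zero.1 h0]
  have hmΓ : h ^ m ∈ Γ := by
    have : h ^ m = γ' * γ⁻¹ := by
      rw [hγ γ (hall γ hγΓ), hγ γ' (hall γ' hγΓ'), heq, hm, zpow_sub]
      group
    rw [this]
    exact Γ.mul_mem hγΓ' (Γ.inv_mem hγΓ)
  have hclose : ∀ g : G, HausdorffClose κ₀ (axis o h 1) (axis o h g) := by
    intro g
    by_contra hg
    have hnear : ∀ k : ℤ, dist ((g * h ^ (m * k)) • o) (P 1 ((g * h ^ (m * k)) • o)) ≤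
        κ₀ + dist o (g • o) := by
      intro k
      have hmem : g * h ^ (m * k) * g⁻¹ ∈ Γ := by
        rw [zpow_mul]
        exact hΓ.conj_mem _ (Γ.zpow_mem hmΓ k) g
      obtain ⟨a, ha, hda⟩ := (hall _ hmem).2 _ (mem_axis_self o h _)
      have h1 := (sys.proj 1).nearest ((g * h ^ (m * k)) • o) a ha
      have h2 := dist_triangle ((g * h ^ (m * k)) • o) ((g * h ^ (m * k) * g⁻¹) • o) a
      have h3 : dist ((g * h ^ (m * k)) • o) ((g * h ^ (m * k) * g⁻¹) • o) = dist o (g • o) := by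
        rw [mul_smul (g * h ^ (m * k)), hIso, ← hIso g, smul_inv_smul, dist_comm]
      linarith
    obtain ⟨N, hN⟩ := exists_lt_dist_zpow hSC (2 * (κ₀ + dist o (g • o)) + κ)
    have h1 := hnear N
    have h2 := hnear 0
    have h3 := sys.dist_le_of_not_close 1 g hg _ (mem_axis_zpow o h g (m * N)) _
      (mem_axis_zpow o h g (m * 0))
    have h4 := dist_triangle4 ((g * h ^ (m * (N : ℤ))) • o) (P 1 ((g * h ^ (m * (N : ℤ))) • o))
      (P 1 ((g * h ^ (m * 0)) • o)) ((g * h ^ (m * 0)) • o)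
    rw [dist_comm (P 1 ((g * h ^ (m * 0)) • o))] at h4
    have h5 : dist ((g * h ^ (m * (N : ℤ))) • o) ((g * h ^ (m * 0)) • o) =
        dist o (h ^ (m * (N : ℤ)) • o) := by
      rw [mul_smul, mul_smul, hIso, dist_comm]
      simp
    have h6 := hN (m * N) (by
      rw [abs_mul, Nat.abs_cast]
      exact le_mul_of_one_le_left (by positivity) (Int.one_le_abs hm0))
    linarith
  have hsurj : Function.Surjective
      fun t : {g : G | dist o (g • o) ≤ κ₀} => (QuotientGroup.mk (t : G)⁻¹ :
        G ⧸ Subgroup.zpowers h) := by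
    intro q
    induction q using QuotientGroup.induction_on with
    | H g =>
      refine ⟨⟨s g⁻¹, hs _ (hclose _)⟩, ?_⟩
      rw [QuotientGroup.eq, inv_inv]
      refine ⟨-i g⁻¹, ?_⟩
      have h1 := hγ _ (hclose g⁻¹)
      calc h ^ (-i g⁻¹) = h ^ (-i g⁻¹) * g⁻¹ * g := by group
        _ = h ^ (-i g⁻¹) * (h ^ i g⁻¹ * s g⁻¹) * g := by rw [← h1]
        _ = s g⁻¹ * g := by group
  have := hfin.to_subtype
  have := Finite.of_surjective _ hsurj
  exact Subgroup.index_ne_zero_of_finite (hNE h)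

/-- Every point projects near `o` on the axis, up to left multiplication by `1` or `γ⁻¹`. -/
theorem exists_dist_proj_smul_le (sys : ContractingSystem o h P κ₀ κ) {γ : G}
    (hγ : ¬ HausdorffClose κ₀ (axis o h 1) (axis o h γ)) (hIso : IsometricAction G X) (x : X) :
    ∃ s : G, (s = 1 ∨ s = γ⁻¹) ∧ dist o (P 1 (s • x)) ≤ 2 * κ + dist o (γ • o) := by
  have hfix : P 1 o = o :=
    (sys.proj 1).apply_of_mem (by simpa using mem_axis_self o h 1)
  have hlip := fun y => (sys.proj 1).dist_proj_le o y
  rw [hfix] at hlip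
  rcases sys.behrstock 1 γ hγ x o (by simpa using mem_axis_self o h 1) (γ • o)
    (mem_axis_self o h γ) with h1 | h1
  · refine ⟨1, Or.inl rfl, ?_⟩
    rw [one_smul]
    linarith [dist_triangle_right o (P 1 x) (P 1 (γ • o)), hlip (γ • o)]
  · refine ⟨γ⁻¹, Or.inr rfl, ?_⟩
    have h2 : ∀ y, P γ y = γ • P 1 (γ⁻¹ • y) := fun y => by
      rw [← sys.smul, mul_one, smul_inv_smul]
    rw [h2, h2, hIso] at h1
    have h3 : dist o (γ⁻¹ • o) = dist o (γ • o) := by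
      rw [← hIso.dist_smul_left, dist_comm]
    linarith [dist_triangle_right o (P 1 (γ⁻¹ • x)) (P 1 (γ⁻¹ • o)), hlip (γ⁻¹ • o)]

/-- `b` translates the axis to a transverse one, with `o` and `b • o` having bounded projections
to both. -/
structure IsTransverse (o : X) (h : G) (P : G → X → X) (κ₀ κ₁ : ℝ) (b : G) : Prop where
  not_close : ¬ HausdorffClose κ₀ (axis o h 1) (axis o h b)
  dist_le : dist o (P 1 (b • o)) ≤ κ₁
  dist_smul_le : dist (b • o) (P b o) ≤ κ₁

theorem isTransverse_of_lt (sys : ContractingSystem o h P κ₀ κ) (hIso : IsometricAction G X)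
    {κ₁ : ℝ} {b : G} (h1 : dist o (P 1 (b • o)) ≤ κ₁) (h2 : dist o (P 1 (b⁻¹ • o)) ≤ κ₁)
    (hb : 2 * κ₁ + κ < dist o (b • o)) : IsTransverse o h P κ₀ κ₁ b := by
  have hfix : P b (b • o) = b • o := (sys.proj b).apply_of_mem (mem_axis_self o h b)
  have h3 : dist (b • o) (P b o) ≤ κ₁ := by
    have := sys.smul b 1 (b⁻¹ • o)
    rw [mul_one, smul_inv_smul] at this
    rwa [this, hIso]
  refine ⟨fun hcl => ?_, h1, h3⟩
  have h4 := sys.dist_le_of_close _ _ hcl (b • o)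
  rw [hfix] at h4
  have := (sys.proj 1).nonneg
  have : 0 ≤ κ₁ := dist_nonneg.trans h1
  linarith [dist_triangle o (P 1 (b • o)) (b • o)]

section Word

variable {γ : G} {n : ℤ} {κ₁ : ℝ}

/-- The positions of the projections of `o` and of `(b * h ^ n * γ * h ^ (-n) * v) • o` to the two
axes determined by the subword `h ^ n * γ * h ^ (-n)`. -/
structure WordBounds (o : X) (h γ : G) (n : ℤ) (P : G → X → X) (κ κ₁ : ℝ) (b w : G) : Prop where
  left_fst : dist (b • o) (P b o) ≤ κ₁
  right_fst : dist ((b * h ^ n) • o) (P b (w • o)) ≤ 2 * κ + dist o (γ • o)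
  left_snd : dist ((b * h ^ n * γ) • o) (P (b * (h ^ n * γ * h ^ (-n))) o) ≤
    2 * κ + dist o (γ • o)
  right_snd : dist ((b * (h ^ n * γ * h ^ (-n))) • o) (P (b * (h ^ n * γ * h ^ (-n))) (w • o)) ≤
    κ + κ₁
  base : dist o (P 1 (w • o)) ≤ κ + κ₁

theorem wordBounds (sys : ContractingSystem o h P κ₀ κ) (hIso : IsometricAction G X)
    (hγ : ¬ HausdorffClose κ₀ (axis o h 1) (axis o h γ))
    (hn : 10 * κ + 10 * κ₁ + 10 * dist o (γ • o) < dist o (h ^ n • o))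
    {b v : G} (hb : IsTransverse o h P κ₀ κ₁ b) (hv : dist o (P 1 (v • o)) ≤ κ + κ₁) :
    WordBounds o h γ n P κ κ₁ b (b * (h ^ n * γ * h ^ (-n)) * v) := by
  have hκ := (sys.proj 1).nonneg
  have hκ₁ : 0 ≤ κ₁ := dist_nonneg.trans hb.dist_le
  have hℓ : 0 ≤ dist o (γ • o) := dist_nonneg
  set k := b * (h ^ n * γ * h ^ (-n)) with hk
  set ℓ := dist o (γ • o)
  set y := (b * h ^ n) • o with hy
  set z := (b * h ^ n * γ) • o with hz
  have hyb : y ∈ axis o h b := mem_axis_zpow o h b n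
  have hzk : z ∈ axis o h k := mem_axis_snd o h γ b n
  have hyz : dist y z = ℓ := by rw [hy, hz, mul_smul _ γ, hIso]
  have hby : dist (b • o) y = dist o (h ^ n • o) := by rw [hy, mul_smul, hIso]
  have hkz : dist (k • o) z = dist o (h ^ n • o) := by
    have : z = k • h ^ n • o := by rw [hz, hk, ← mul_smul]; group
    rw [this, hIso]
  have hbk : ¬ HausdorffClose κ₀ (axis o h b) (axis o h k) := by
    intro hcl
    apply hγ
    have h1 := hcl.translate hIso (b * h ^ n)⁻¹
    have h2 : (b * h ^ n)⁻¹ * b = 1 * h ^ (-n) := by group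
    have h3 : (b * h ^ n)⁻¹ * k = γ * h ^ (-n) := by rw [hk]; group
    rwa [h2, h3, axis_mul_zpow, axis_mul_zpow] at h1
  have hright_snd : dist (k • o) (P k ((k * v) • o)) ≤ κ + κ₁ := by
    have := sys.smul k 1 (v • o)
    rw [mul_one, ← mul_smul] at this
    rwa [this, hIso]
  set w := (k * v) • o
  have hPby : P b y = y := (sys.proj b).apply_of_mem hyb
  have hPkz : P k z = z := (sys.proj k).apply_of_mem hzk
  have hPb : P b (b • o) = b • o := (sys.proj b).apply_of_mem (mem_axis_self o h b)
  have hlipb := (sys.proj b).dist_proj_le y z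
  have hlipk := (sys.proj k).dist_proj_le y z
  rw [hPby] at hlipb
  rw [hPkz] at hlipk
  have hright_fst : dist y (P b w) ≤ 2 * κ + ℓ := by
    rcases sys.behrstock b k hbk w y hyb z hzk with h1 | h1
    · linarith [dist_triangle_right y (P b w) (P b z)]
    · linarith [dist_triangle4 (k • o) (P k w) (P k y) z]
  have hleft_snd : dist z (P k o) ≤ 2 * κ + ℓ := by
    rcases sys.behrstock b k hbk o y hyb z hzk with h1 | h1
    · have h2 := dist_triangle4 (b • o) (P b o) (P b z) y
      linarith [hb.dist_smul_le, dist_comm y (P b z), dist_comm y (b • o),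
        dist_triangle_right z y (P b z), hyz]
    · have h2 := dist_triangle z (P k y) (P k o)
      linarith [dist_comm z (P k y), dist_comm (P k y) (P k o)]
  refine ⟨hb.dist_smul_le, hright_fst, hleft_snd, hright_snd, ?_⟩
  rcases sys.behrstock 1 b hb.not_close w o (by simpa using mem_axis_self o h 1) (b • o)
    (mem_axis_self o h b) with h1 | h1
  · linarith [dist_triangle_right o (P 1 w) (P 1 (b • o)), hb.dist_le]
  · have h2 := dist_triangle4 (b • o) (P b o) (P b w) y
    linarith [hb.dist_smul_le, dist_comm (P b o) (P b w), dist_comm (P b w) y]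

theorem false_of_wordBounds (sys : ContractingSystem o h P κ₀ κ) (hIso : IsometricAction G X)
    {K : ℝ} (hK : 0 ≤ K)
    (hn : K + 20 * κ + 20 * κ₁ + 20 * dist o (γ • o) < dist o (h ^ n • o))
    {b b' w : G} (hw : WordBounds o h γ n P κ κ₁ b w) (hw' : WordBounds o h γ n P κ κ₁ b' w)
    (hfar : dist o (h ^ n • o) + 10 * κ + 10 * κ₁ + 10 * dist o (γ • o) <
      dist (b • o) (b' • o))
    (hmin : dist o (b' • o) ≤
      K + dist o (b • o) + dist ((b * (h ^ n * γ * h ^ (-n))) • o) (b' • o))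
    (hfirst : dist (P b (w • o)) (P b (b' • o)) ≤ κ) : False := by
  have hκ := (sys.proj 1).nonneg
  have hκ₁ : 0 ≤ κ₁ := dist_nonneg.trans hw.left_fst
  have hℓ : 0 ≤ dist o (γ • o) := dist_nonneg
  obtain ⟨hlf, hrf, hls, hrs, -⟩ := hw
  obtain ⟨hlf', hrf', -, -, -⟩ := hw'
  have hyb : (b * h ^ n) • o ∈ axis o h b := mem_axis_zpow o h b n
  have hzk := mem_axis_snd o h γ b n
  have hkz : dist ((b * (h ^ n * γ * h ^ (-n))) • o) ((b * h ^ n * γ) • o) =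
      dist o (h ^ n • o) := by
    have : (b * h ^ n * γ) • o = (b * (h ^ n * γ * h ^ (-n))) • h ^ n • o := by
      rw [← mul_smul]; group
    rw [this, hIso]
  have hyz : dist ((b * h ^ n) • o) ((b * h ^ n * γ) • o) = dist o (γ • o) := by
    rw [mul_smul _ γ, hIso]
  have hby : dist (b • o) ((b * h ^ n) • o) = dist o (h ^ n • o) := by rw [mul_smul, hIso]
  have hby' : dist (b' • o) ((b' * h ^ n) • o) = dist o (h ^ n • o) := by rw [mul_smul, hIso]
  generalize (b * h ^ n) • o = y at *
  generalize (b * h ^ n * γ) • o = z at *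
  generalize (b' * h ^ n) • o = y' at *
  generalize b * (h ^ n * γ * h ^ (-n)) = k at *
  generalize w • o = x at *
  set H := dist o (h ^ n • o)
  set ℓ := dist o (γ • o)
  have hb'k : ¬ HausdorffClose κ₀ (axis o h b') (axis o h k) := by
    intro hcl
    have h1 := sys.dist_le_of_close _ _ hcl o
    have h2 := dist_triangle4 (b' • o) (P b' o) (P k o) z
    rw [dist_comm (P k o) z] at h2
    have h3 := dist_triangle4 (b • o) y z (b' • o)
    rw [dist_comm z] at h3
    linarith
  have hbb' : ¬ HausdorffClose κ₀ (axis o h b) (axis o h b') := by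
    intro hcl
    have h1 := sys.dist_le_of_close _ _ hcl o
    have h2 := dist_triangle4 (b • o) (P b o) (P b' o) (b' • o)
    have : 0 ≤ H := dist_nonneg
    linarith [dist_comm (P b' o) (b' • o)]
  rcases sys.behrstock b' k hb'k x (b' • o) (mem_axis_self o h b') z hzk with h1 | h1
  · rcases sys.behrstock b b' hbb' o y hyb (b' • o) (mem_axis_self o h b') with h2 | h2
    · have h3 := dist_triangle4 (b • o) (P b o) (P b (b' • o)) (P b x)
      have h4 := dist_triangle_right (b • o) y (P b x)
      rw [dist_comm (P b (b' • o))] at h3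
      linarith
    · have h3 := (sys.proj b').dist_proj_le y z
      have h4 := dist_triangle4 (b' • o) (P b' o) (P b' y) (P b' z)
      have h5 := dist_triangle4 (b' • o) (P b' z) (P b' x) y'
      linarith [dist_comm (P b' z) (P b' x), dist_comm (P b' x) y']
  · have h2 := dist_triangle_right (k • o) (P k (b' • o)) (P k x)
    rw [dist_comm (P k (b' • o))] at h2
    have h3 := dist_triangle4 (k • o) (P k (b' • o)) (P k o) z
    rw [dist_comm (P k (b' • o)) (P k o), dist_comm (P k o) z] at h3
    have h4 := (sys.proj k).additive o (b' • o) (by linarith)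
    have h5 := dist_triangle4 o (P k o) z y
    rw [dist_comm _ z, dist_comm z y] at h5
    have h6 := (sys.proj b).dist_add_dist_le hyb o
    rw [dist_comm y (P b o), dist_comm (P b o) o, dist_comm y o] at h6
    have h7 := dist_triangle (b • o) (P b o) y
    have h8 := dist_triangle_right o (b • o) (P b o)
    have h9 := dist_triangle (k • o) (P k (b' • o)) (b' • o)
    linarith

/-- The words in the elements `b * (h ^ n * γ * h ^ (-n))`, for `b` in a separated set of
transverse elements, have a well-defined first letter. -/
theorem eq_of_word_eq (sys : ContractingSystem o h P κ₀ κ) (hIso : IsometricAction G X)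
    (hγ : ¬ HausdorffClose κ₀ (axis o h 1) (axis o h γ)) {K : ℝ} (hK : 0 ≤ K)
    (hn : K + 20 * κ + 20 * κ₁ + 20 * dist o (γ • o) < dist o (h ^ n • o))
    {b b' v v' : G} (hb : IsTransverse o h P κ₀ κ₁ b) (hb' : IsTransverse o h P κ₀ κ₁ b')
    (hv : dist o (P 1 (v • o)) ≤ κ + κ₁) (hv' : dist o (P 1 (v' • o)) ≤ κ + κ₁)
    (hsep : b ≠ b' → dist o (h ^ n • o) + 10 * κ + 10 * κ₁ + 10 * dist o (γ • o) <
      dist (b • o) (b' • o))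
    (hmin : dist o (b' • o) ≤
      K + dist o (b • o) + dist ((b * (h ^ n * γ * h ^ (-n))) • o) (b' • o))
    (hmin' : dist o (b • o) ≤
      K + dist o (b' • o) + dist ((b' * (h ^ n * γ * h ^ (-n))) • o) (b • o))
    (heq : b * (h ^ n * γ * h ^ (-n)) * v = b' * (h ^ n * γ * h ^ (-n)) * v') : b = b' := by
  by_contra hne
  have hκ := (sys.proj 1).nonneg
  have hκ₁ : 0 ≤ κ₁ := dist_nonneg.trans hb.dist_le
  have hℓ : 0 ≤ dist o (γ • o) := dist_nonneg
  have hfar := hsep hne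
  have hw := sys.wordBounds hIso hγ (by linarith) hb hv
  have hw' := sys.wordBounds hIso hγ (by linarith) hb' hv'
  rw [← heq] at hw'
  set w := b * (h ^ n * γ * h ^ (-n)) * v
  have hbb' : ¬ HausdorffClose κ₀ (axis o h b) (axis o h b') := by
    intro hcl
    have h1 := sys.dist_le_of_close _ _ hcl o
    have h2 := dist_triangle4 (b • o) (P b o) (P b' o) (b' • o)
    have : 0 ≤ dist o (h ^ n • o) := dist_nonneg
    linarith [hw.left_fst, hw'.left_fst, dist_comm (P b' o) (b' • o)]
  rcases sys.behrstock b b' hbb' (w • o) (b • o) (mem_axis_self o h b) (b' • o)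
    (mem_axis_self o h b') with h1 | h1
  · exact sys.false_of_wordBounds hIso hK hn hw hw' hfar hmin h1
  · exact sys.false_of_wordBounds hIso hK hn hw' hw (by rwa [dist_comm (b' • o)]) hmin' h1

end Word

end ContractingSystem

end FreeSemigroup


section Counting

open Real (exp log)

/-- If the elements of `T` followed by `F` freely generate a semigroup acting on `V`, then the
powers of the Poincaré sum of `T` are bounded by Poincaré sums over subsets of `V`. -/
theorem exists_pow_sum_exp_le {G : Type*} [Group G] {L : G → ℝ} (hL1 : L 1 = 0)
    (hL : ∀ a b, L (a * b) ≤ L a + L b) {T : Finset G} {F : G} {V : Set G} (h1 : 1 ∈ V)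
    (hV : ∀ b ∈ T, ∀ v ∈ V, b * F * v ∈ V)
    (hinj : ∀ b ∈ T, ∀ b' ∈ T, ∀ v ∈ V, ∀ v' ∈ V, b * F * v = b' * F * v' → b = b')
    {s : ℝ} (hs : 0 ≤ s) (k : ℕ) :
    ∃ W : Finset G, (W : Set G) ⊆ V ∧
      (∑ b ∈ T, exp (-s * (L b + L F))) ^ k ≤ ∑ w ∈ W, exp (-s * L w) := by
  classical
  induction k with
  | zero => exact ⟨{1}, by simpa using h1, by simp [hL1]⟩
  | succ k ih =>
    obtain ⟨W, hWV, hW⟩ := ih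
    have hinj' : Set.InjOn (fun p : G × G => p.1 * F * p.2) (T ×ˢ W : Finset (G × G)) := by
      rintro ⟨b, v⟩ hb ⟨b', v'⟩ hb' heq
      simp only [Finset.coe_product, Set.mem_prod, Finset.mem_coe] at hb hb' heq
      obtain rfl := hinj b hb.1 b' hb'.1 v (hWV hb.2) v' (hWV hb'.2) heq
      simpa using heq
    refine ⟨(T ×ˢ W).image fun p => p.1 * F * p.2, ?_, ?_⟩
    · intro w hw
      simp only [Finset.coe_image, Set.mem_image, Finset.mem_coe, Finset.mem_product] at hw
      obtain ⟨p, ⟨hb, hv⟩, rfl⟩ := hw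
      exact hV _ hb _ (hWV hv)
    · rw [Finset.sum_image hinj', Finset.sum_product, pow_succ']
      calc (∑ b ∈ T, exp (-s * (L b + L F))) * (∑ b ∈ T, exp (-s * (L b + L F))) ^ k
          ≤ (∑ b ∈ T, exp (-s * (L b + L F))) * ∑ w ∈ W, exp (-s * L w) := by gcongr
        _ ≤ _ := by
          rw [Finset.sum_mul]
          refine Finset.sum_le_sum fun b _ => ?_
          rw [Finset.mul_sum]
          refine Finset.sum_le_sum fun w _ => ?_
          rw [← Real.exp_add, Real.exp_le_exp]
          have h2 := mul_le_mul_of_nonneg_left ((hL (b * F) w).trans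
            (add_le_add_left (hL b F) (L w))) hs
          linarith

/-- A set with exponential growth rate less than `s` has bounded Poincaré sums at `s`. -/
theorem exists_sum_exp_le_of_ncard_le {α : Type*} {L : α → ℝ} (hL : ∀ a, 0 ≤ L a)
    (hfin : ∀ r, {a | L a ≤ r}.Finite) {s' s r₀ : ℝ} (hs' : 0 ≤ s') (hs : s' < s)
    (hcard : ∀ r ≥ r₀, ({a | L a ≤ r}.ncard : ℝ) ≤ exp (s' * r)) :
    ∃ M, ∀ W : Finset α, ∑ w ∈ W, exp (-s * L w) ≤ M := by
  set c : ℕ → ℝ := fun j => ({a | L a ≤ (j + 1 : ℕ)}.ncard : ℝ) * exp (-s * j) with hc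
  have hc0 : ∀ j, 0 ≤ c j := fun j => by positivity
  have hsum : Summable c := by
    have hgeo : Summable fun j : ℕ => exp s' * exp (s' - s) ^ j :=
      (summable_geometric_of_lt_one (Real.exp_pos _).le
        (Real.exp_lt_one_iff.2 (by linarith))).mul_left _
    refine Summable.of_norm_bounded_eventually_nat hgeo ?_
    filter_upwards [eventually_ge_atTop ⌈r₀⌉₊] with j hj
    rw [Real.norm_of_nonneg (hc0 j)]
    have hj' : r₀ ≤ (j + 1 : ℕ) := by
      have := Nat.ceil_le.1 hj
      push_cast
      linarith
    calc c j ≤ exp (s' * (j + 1 : ℕ)) * exp (-s * j) := by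
          simp only [hc]
          gcongr
          exact hcard _ hj'
      _ = exp s' * exp (s' - s) ^ j := by
          rw [← Real.exp_nat_mul, ← Real.exp_add, ← Real.exp_add]
          push_cast
          ring_nf
  refine ⟨∑' j, c j, fun W => ?_⟩
  classical
  have hmaps : ∀ w ∈ W, ⌊L w⌋₊ ∈ W.image fun w => ⌊L w⌋₊ := fun w hw =>
    Finset.mem_image_of_mem _ hw
  rw [← Finset.sum_fiberwise_of_maps_to hmaps]
  refine le_trans (Finset.sum_le_sum fun j _ => ?_)
    (hsum.sum_le_tsum _ fun j _ => hc0 j)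
  have hs0 : 0 ≤ s := hs'.trans hs.le
  have hterm : ∀ w ∈ W.filter (fun w => ⌊L w⌋₊ = j), exp (-s * L w) ≤ exp (-s * j) := by
    intro w hw
    rw [Real.exp_le_exp]
    have := Nat.floor_le (hL w)
    rw [(Finset.mem_filter.1 hw).2] at this
    linarith [mul_le_mul_of_nonneg_left this hs0]
  refine (Finset.sum_le_card_nsmul _ _ _ hterm).trans ?_
  simp only [nsmul_eq_mul, hc]
  gcongr
  rw [← Set.ncard_coe_finset]
  refine Set.ncard_le_ncard (fun w hw => ?_) (hfin _)
  have := Nat.lt_floor_add_one (L w)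
  rw [(Finset.mem_filter.1 (Finset.mem_coe.1 hw)).2] at this
  exact_mod_cast this.le

/-- The limit superior of exponential growth rates controls cardinalities. -/
theorem exists_card_le_exp_of_limsup_lt {f : ℝ → ℕ} {s : ℝ}
    (hf : limsup (fun r : ℝ => ENNReal.ofReal (log (f r) / r)) atTop < ENNReal.ofReal s) :
    ∃ r₀, ∀ r ≥ r₀, (f r : ℝ) ≤ exp (s * r) := by
  have hs : 0 < s := ENNReal.ofReal_pos.1 (bot_le.trans_lt hf)
  obtain ⟨r₁, hr₁⟩ := eventually_atTop.1 (eventually_lt_of_limsup_lt hf)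
  refine ⟨max r₁ 1, fun r hr => ?_⟩
  have hr0 : 0 < r := zero_lt_one.trans_le ((le_max_right _ _).trans hr)
  have h1 := hr₁ r ((le_max_left _ _).trans hr)
  rw [ENNReal.ofReal_lt_ofReal_iff hs, div_lt_iff₀ hr0] at h1
  rcases Nat.eq_zero_or_pos (f r) with h0 | h0
  · rw [h0, Nat.cast_zero]
    positivity
  · exact ((Real.log_lt_iff_lt_exp (by exact_mod_cast h0)).1 h1).le

theorem limsup_le_of_card_le_exp {f : ℝ → ℕ} {s c : ℝ} (hs : 0 ≤ s)
    (hf : ∀ᶠ r in atTop, (f r : ℝ) ≤ exp (s * r + c)) :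
    limsup (fun r : ℝ => ENNReal.ofReal (log (f r) / r)) atTop ≤ ENNReal.ofReal s := by
  have hlim : Tendsto (fun r : ℝ => ENNReal.ofReal (s + |c| / r)) atTop
      (nhds (ENNReal.ofReal s)) := by
    refine ENNReal.tendsto_ofReal ?_
    simpa using (tendsto_const_nhds (x := s)).add
      ((tendsto_const_nhds (x := |c|)).div_atTop tendsto_id)
  rw [← hlim.limsup_eq]
  refine limsup_le_limsup ?_
  filter_upwards [hf, eventually_gt_atTop 0] with r hr hr0
  refine ENNReal.ofReal_le_ofReal ?_
  rw [div_le_iff₀ hr0, add_mul, div_mul_cancel₀ _ hr0.ne']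
  rcases Nat.eq_zero_or_pos (f r) with h0 | h0
  · rw [h0]
    simp only [Nat.cast_zero, Real.log_zero]
    positivity
  · have := (Real.log_le_iff_le_exp (by exact_mod_cast h0)).2 hr
    linarith [le_abs_self c]

end Counting

section GroupGrowth

open Real (exp log)

variable {G X : Type*} [Group G] [MetricSpace X] [MulAction G X]

theorem IsometricAction.dist_mul_smul_le (hIso : IsometricAction G X) (o : X) (a b : G) :
    dist o ((a * b) • o) ≤ dist o (a • o) + dist o (b • o) := by
  have := dist_triangle o (a • o) ((a * b) • o)
  rwa [mul_smul, hIso, ← mul_smul] at this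

theorem IsometricAction.dist_inv_smul (hIso : IsometricAction G X) (o : X) (a : G) :
    dist o (a⁻¹ • o) = dist o (a • o) := by
  rw [← hIso.dist_smul_left, dist_comm]

variable [ProperSpace X]

theorem sum_exp_le_one_of_growthExp_le (hIso : IsometricAction G X)
    (hPD : ProperlyDiscontinuousAction G X) {o : X} {T : Finset G} {F : G} {V : Set G}
    (h1 : 1 ∈ V) (hV : ∀ b ∈ T, ∀ v ∈ V, b * F * v ∈ V)
    (hinj : ∀ b ∈ T, ∀ b' ∈ T, ∀ v ∈ V, ∀ v' ∈ V, b * F * v = b' * F * v' → b = b')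
    {δ : ℝ} (hδ : 0 ≤ δ) (hgr : growthExp o (Set.univ : Set G) ≤ ENNReal.ofReal δ) :
    ∑ b ∈ T, exp (-δ * (dist o (b • o) + dist o (F • o))) ≤ 1 := by
  have key : ∀ s > δ, ∑ b ∈ T, exp (-s * (dist o (b • o) + dist o (F • o))) ≤ 1 := by
    intro s hs
    obtain ⟨s', hδs', hs's⟩ := exists_between hs
    have hlt : growthExp o (Set.univ : Set G) < ENNReal.ofReal s' :=
      hgr.trans_lt ((ENNReal.ofReal_lt_ofReal_iff (hδ.trans_lt hδs')).2 hδs')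
    obtain ⟨r₀, hr₀⟩ := exists_card_le_exp_of_limsup_lt hlt
    obtain ⟨M, hM⟩ := exists_sum_exp_le_of_ncard_le (L := fun g : G => dist o (g • o))
      (fun _ => dist_nonneg) (finite_setOf_dist_le hPD o) (hδ.trans hδs'.le) hs's
      (r₀ := r₀) fun r hr => by
        have hcard := hr₀ r hr
        simp only [Set.mem_univ, true_and] at hcard
        rw [← Nat.card_coe_set_eq]
        exact hcard
    by_contra! hgt
    obtain ⟨k, hk⟩ := pow_unbounded_of_one_lt M hgt
    obtain ⟨W, -, hW⟩ := exists_pow_sum_exp_le (L := fun g : G => dist o (g • o)) (by simp)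
      (hIso.dist_mul_smul_le o) h1 hV hinj ((hδ.trans hs.le)) k
    exact absurd (hk.trans_le (hW.trans (hM W))) (lt_irrefl _)
  have hcont : Continuous fun s : ℝ =>
      ∑ b ∈ T, exp (-s * (dist o (b • o) + dist o (F • o))) := by fun_prop
  exact le_of_tendsto ((hcont.tendsto δ).mono_left nhdsWithin_le_nhds)
    (eventually_nhdsWithin_of_forall (s := Set.Ioi δ) key)

namespace ContractingSystem

variable {o : X} {h : G} {P : G → X → X} {κ₀ κ : ℝ}

theorem sum_exp_le_one (sys : ContractingSystem o h P κ₀ κ) (hIso : IsometricAction G X)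
    (hPD : ProperlyDiscontinuousAction G X) {γ : G}
    (hγ : ¬ HausdorffClose κ₀ (axis o h 1) (axis o h γ)) {K κ₁ : ℝ} {n : ℤ} (hK : 0 ≤ K)
    (hκ₁ : 0 ≤ κ₁)
    (hn : K + 20 * κ + 20 * κ₁ + 20 * dist o (γ • o) < dist o (h ^ n • o)) {T : Finset G}
    (hT : ∀ b ∈ T, IsTransverse o h P κ₀ κ₁ b)
    (hsep : ∀ b ∈ T, ∀ b' ∈ T, b ≠ b' →
      dist o (h ^ n • o) + 10 * κ + 10 * κ₁ + 10 * dist o (γ • o) < dist (b • o) (b' • o))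
    (hmin : ∀ b ∈ T, ∀ b' ∈ T, dist o (b' • o) ≤
      K + dist o (b • o) + dist ((b * (h ^ n * γ * h ^ (-n))) • o) (b' • o))
    {δ : ℝ} (hδ : 0 ≤ δ) (hgr : growthExp o (Set.univ : Set G) ≤ ENNReal.ofReal δ) :
    ∑ b ∈ T, exp (-δ * (dist o (b • o) + dist o ((h ^ n * γ * h ^ (-n)) • o))) ≤ 1 := by
  have hκ := (sys.proj 1).nonneg
  have hℓ : 0 ≤ dist o (γ • o) := dist_nonneg
  refine sum_exp_le_one_of_growthExp_le hIso hPD (V := {v | dist o (P 1 (v • o)) ≤ κ + κ₁})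
    ?_ ?_ ?_ hδ hgr
  · have hfix : P 1 o = o :=
      (sys.proj 1).apply_of_mem (by simpa using mem_axis_self o h 1)
    simp only [Set.mem_ofPred_eq, one_smul, hfix, dist_self]
    linarith
  · exact fun b hb v hv => (sys.wordBounds hIso hγ (by linarith) (hT b hb) hv).base
  · exact fun b hb b' hb' v hv v' hv' heq => sys.eq_of_word_eq hIso hγ hK hn (hT b hb)
      (hT b' hb') hv hv' (hsep b hb b' hb') (hmin b hb b' hb') (hmin b' hb' b hb) heq

theorem growthExp_pos (sys : ContractingSystem o h P κ₀ κ) (hIso : IsometricAction G X)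
    (hPD : ProperlyDiscontinuousAction G X) (hSC : StronglyContractingElem o h) {γ : G}
    (hγ : ¬ HausdorffClose κ₀ (axis o h 1) (axis o h γ)) :
    0 < growthExp o (Set.univ : Set G) := by
  classical
  by_contra! hzero
  have hκ := (sys.proj 1).nonneg
  set ℓ := dist o (γ • o) with hℓ
  have hℓ0 : 0 ≤ ℓ := dist_nonneg
  have hfix : P 1 o = o :=
    (sys.proj 1).apply_of_mem (by simpa using mem_axis_self o h 1)
  have hlip := fun y => (sys.proj 1).dist_proj_le o y
  rw [hfix] at hlip
  set κ₁ := 2 * ℓ + 3 * κ with hκ₁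
  obtain ⟨n, hn⟩ := exists_lt_dist_zpow hSC (20 * κ + 20 * κ₁ + 20 * ℓ)
  specialize hn n (le_abs_self _)
  obtain ⟨m, hm⟩ := exists_lt_dist_zpow hSC
    (dist o (h ^ (n : ℤ) • o) + 10 * κ + 10 * κ₁ + 20 * ℓ)
  have hconj : ∀ i : ℤ, dist ((γ * h ^ i) • o) ((γ * h ^ i * γ⁻¹) • o) = ℓ := fun i => by
    rw [mul_smul _ γ⁻¹, hIso, hIso.dist_inv_smul]
  have hproj : ∀ i : ℤ, dist o (P 1 ((γ * h ^ i * γ⁻¹) • o)) ≤ κ₁ := fun i => by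
    have h1 := hlip (γ • o)
    have h2 := sys.dist_le_of_not_close 1 γ hγ _ (mem_axis_self o h γ) _ (mem_axis_zpow o h γ i)
    have h3 := (sys.proj 1).dist_proj_le ((γ * h ^ i) • o) ((γ * h ^ i * γ⁻¹) • o)
    have h4 := dist_triangle4 o (P 1 (γ • o)) (P 1 ((γ * h ^ i) • o))
      (P 1 ((γ * h ^ i * γ⁻¹) • o))
    rw [hconj] at h3
    linarith
  have hinv : ∀ i : ℤ, (γ * h ^ i * γ⁻¹)⁻¹ = γ * h ^ (-i) * γ⁻¹ := fun i => by group
  have hlong : ∀ i : ℤ, dist o (h ^ i • o) ≤ 2 * ℓ + dist o ((γ * h ^ i * γ⁻¹) • o) := fun i => by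
    have h1 := dist_triangle4 (γ • o) o ((γ * h ^ i * γ⁻¹) • o) ((γ * h ^ i) • o)
    rw [mul_smul γ (h ^ i), hIso] at h1
    have h2 := hconj i
    rw [mul_smul γ (h ^ i)] at h2
    linarith [dist_comm (γ • o) o, dist_comm (γ • h ^ i • o) ((γ * h ^ i * γ⁻¹) • o)]
  have htrans : ∀ i : ℤ, m ≤ |i| → IsTransverse o h P κ₀ κ₁ (γ * h ^ i * γ⁻¹) := fun i hi => by
    refine sys.isTransverse_of_lt hIso (hproj i) ?_ ?_
    · rw [hinv]
      exact hproj _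
    · linarith [hlong i, hm i hi]
  set b₁ := γ * h ^ (m : ℤ) * γ⁻¹ with hb₁
  have hb₁inv : b₁⁻¹ = γ * h ^ (-(m : ℤ)) * γ⁻¹ := hinv m
  have hlen : dist o (b₁⁻¹ • o) = dist o (b₁ • o) := hIso.dist_inv_smul o b₁
  have hdist : dist o (h ^ (n : ℤ) • o) + 10 * κ + 10 * κ₁ + 10 * ℓ <
      dist (b₁ • o) (b₁⁻¹ • o) := by
    rw [hIso.dist_smul_left, ← mul_smul]
    have h1 : b₁⁻¹ * b₁⁻¹ = γ * h ^ (-(2 * m : ℤ)) * γ⁻¹ := by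
      rw [hb₁inv]
      group
    rw [h1]
    have h2 := hm (-(2 * m : ℤ)) (by rw [abs_neg, abs_of_nonneg (by positivity)]; linarith)
    linarith [hlong (-(2 * m : ℤ))]
  have hne : b₁ ≠ b₁⁻¹ := by
    intro heq
    rw [← heq, dist_self] at hdist
    linarith [dist_nonneg (x := o) (y := h ^ (n : ℤ) • o)]
  have hT : ∀ b ∈ ({b₁, b₁⁻¹} : Finset G), b = b₁ ∨ b = b₁⁻¹ := by simp
  have hsum := sys.sum_exp_le_one hIso hPD hγ le_rfl (κ₁ := κ₁) (by positivity) (n := n)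
    (by linarith) (T := {b₁, b₁⁻¹}) ?_ ?_ ?_ le_rfl (by simpa using hzero)
  · rw [Finset.sum_pair hne] at hsum
    norm_num at hsum
  · intro b hb
    rcases hT b hb with rfl | rfl
    · exact htrans _ (le_abs_self _)
    · rw [hb₁inv]
      exact htrans _ (by simp)
  · intro b hb b' hb' hbb'
    rcases hT b hb with rfl | rfl <;> rcases hT b' hb' with rfl | rfl
    · exact absurd rfl hbb'
    · exact hdist
    · rwa [dist_comm (b₁⁻¹ • o)]
    · exact absurd rfl hbb'
  · intro b hb b' hb'
    have : dist o (b' • o) = dist o (b • o) := by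
      rcases hT b hb with rfl | rfl <;> rcases hT b' hb' with rfl | rfl <;> simp [hlen]
    rw [this, zero_add]
    exact le_add_of_nonneg_right dist_nonneg

end ContractingSystem

end GroupGrowth

section QuotientGrowth

open Real (exp log)
open scoped Pointwise

variable {G X : Type*} [Group G] [MetricSpace X] [MulAction G X]

/-- The image in `G ⧸ Γ` of the ball of radius `r` in `G`. -/
def quotBall (o : X) (Γ : Subgroup G) (r : ℝ) : Set (G ⧸ Γ) :=
  QuotientGroup.mk '' {g : G | dist o (g • o) ≤ r}

theorem quotBall_mono (o : X) (Γ : Subgroup G) {r s : ℝ} (hrs : r ≤ s) :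
    quotBall o Γ r ⊆ quotBall o Γ s :=
  Set.image_mono fun _ hg => le_trans hg hrs

theorem one_mem_quotBall (o : X) (Γ : Subgroup G) {r : ℝ} (hr : 0 ≤ r) :
    QuotientGroup.mk 1 ∈ quotBall o Γ r :=
  ⟨1, by simpa using hr, rfl⟩

theorem quotBall_add_subset (hIso : IsometricAction G X) {o : X} (Γ : Subgroup G) [Γ.Normal]
    (hQC : QuasiConvexGSpace G o) :
    ∃ C : ℝ, 0 ≤ C ∧ ∀ r s : ℝ, 0 ≤ r → 0 ≤ s →
      quotBall o Γ (r + s) ⊆ quotBall o Γ (r + C) * quotBall o Γ (s + C) := by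
  obtain ⟨C, hC, hqc⟩ := hQC
  refine ⟨C + 1, by linarith, ?_⟩
  rintro r s hr hs _ ⟨g, hg, rfl⟩
  have hg : dist o (g • o) ≤ r + s := hg
  rcases le_or_gt (dist o (g • o)) r with hgr | hgr
  · refine Set.mem_mul.2 ⟨QuotientGroup.mk g, ⟨g, ?_, rfl⟩, QuotientGroup.mk 1,
      one_mem_quotBall o Γ (by linarith), by simp⟩
    simp only [Set.mem_ofPred_eq]
    linarith
  obtain ⟨c, ⟨hc0, hc1, hc⟩, hnear⟩ := hqc 1 g
  rw [one_smul] at hc0 hc1 hc hnear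
  have hmem : r ∈ Set.Icc 0 (dist o (g • o)) := ⟨hr, hgr.le⟩
  obtain ⟨_, ⟨a, rfl⟩, ha⟩ := (infDist_lt_iff (Set.range_nonempty _)).1
    ((hnear r hmem).trans_lt (lt_add_one C))
  have h1 := hc 0 ⟨le_rfl, dist_nonneg⟩ r hmem
  have h2 := hc r hmem _ ⟨dist_nonneg, le_rfl⟩
  rw [hc0, zero_sub, abs_neg, abs_of_nonneg hr] at h1
  rw [hc1, abs_of_nonpos (by linarith)] at h2
  have h3 := dist_triangle o (c r) (a • o)
  have h4 := dist_triangle_left (a • o) (g • o) (c r)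
  refine Set.mem_mul.2 ⟨QuotientGroup.mk a, ⟨a, ?_, rfl⟩, QuotientGroup.mk (a⁻¹ * g),
    ⟨a⁻¹ * g, ?_, rfl⟩, ?_⟩
  · simp only [Set.mem_ofPred_eq]
    linarith
  · simp only [Set.mem_ofPred_eq]
    rw [mul_smul, ← hIso.dist_smul_left]
    linarith
  · rw [← QuotientGroup.mk_mul, mul_inv_cancel_left]

variable [ProperSpace X]

theorem finite_quotBall (hPD : ProperlyDiscontinuousAction G X) (o : X) (Γ : Subgroup G) (r : ℝ) :
    (quotBall o Γ r).Finite :=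
  (finite_setOf_dist_le hPD o r).image _

theorem quotGrowthExp_le_of_ncard_le (hPD : ProperlyDiscontinuousAction G X) {o : X}
    {Γ : Subgroup G} {s c : ℝ} (hs : 0 ≤ s)
    (hcard : ∀ r ≥ 0, ((quotBall o Γ (r + 1)).ncard : ℝ) ≤ exp (s * r + c)) :
    quotGrowthExp o Γ ≤ ENNReal.ofReal s := by
  refine limsup_le_of_card_le_exp hs (c := c) ?_
  filter_upwards [eventually_ge_atTop 0] with r hr
  refine le_trans ?_ (hcard r hr)
  rw [← Nat.card_coe_set_eq, Nat.cast_le]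
  have := (finite_quotBall hPD o Γ (r + 1)).to_subtype
  refine Nat.card_le_card_of_injective (fun q => ⟨q.1, ?_⟩)
    fun q q' hqq' => Subtype.ext (Subtype.mk.inj hqq')
  obtain ⟨g, hg, hr⟩ := q.2
  obtain ⟨γ, hγ⟩ := exists_lt_of_ciInf_lt (hr.trans_lt (lt_add_one r))
  exact ⟨g * γ, hγ.le, by rw [← hg, QuotientGroup.mk_mul_of_mem g γ.2]⟩

/-- Quotient ball cardinalities are submultiplicative up to a shift of the radius, so that their
growth is bounded by what happens at a single radius. -/
theorem exists_quotGrowthExp_le_of_ncard_le (hIso : IsometricAction G X)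
    (hPD : ProperlyDiscontinuousAction G X) {o : X} (Γ : Subgroup G) [Γ.Normal]
    (hQC : QuasiConvexGSpace G o) :
    ∃ C : ℝ, ∀ r₀ s : ℝ, 0 < r₀ → 0 ≤ s →
      ((quotBall o Γ (r₀ + C)).ncard : ℝ) ≤ exp (s * r₀) →
        quotGrowthExp o Γ ≤ ENNReal.ofReal s := by
  obtain ⟨C, hC, hmul⟩ := quotBall_add_subset hIso Γ hQC
  refine ⟨2 * C, fun r₀ s hr₀ hs hcard => ?_⟩
  set p : ℝ → ℝ := fun r => (quotBall o Γ (r + 2 * C)).ncard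
  have hp : ∀ r t, 0 ≤ r → 0 ≤ t → p (r + t) ≤ p r * p t := fun r t hr ht => by
    have h1 := hmul (r + C) (t + C) (by linarith) (by linarith)
    rw [show r + C + (t + C) = r + t + 2 * C by ring, show r + C + C = r + 2 * C by ring,
      show t + C + C = t + 2 * C by ring] at h1
    have h2 := Set.ncard_le_ncard h1
      ((finite_quotBall hPD o Γ _).mul (finite_quotBall hPD o Γ _))
    have h3 : (quotBall o Γ (r + 2 * C) * quotBall o Γ (t + 2 * C)).ncard ≤
        (quotBall o Γ (r + 2 * C)).ncard * (quotBall o Γ (t + 2 * C)).ncard := by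
      simpa only [Nat.card_coe_set_eq] using
        Set.natCard_mul_le (s := quotBall o Γ (r + 2 * C)) (t := quotBall o Γ (t + 2 * C))
    simp only [p]
    exact_mod_cast h2.trans h3
  have hpow : ∀ k : ℕ, p (k * r₀) ≤ p 0 * exp (s * r₀) ^ k := fun k => by
    induction k with
    | zero => simp
    | succ k ih =>
      calc p ((k + 1 : ℕ) * r₀) = p (k * r₀ + r₀) := by push_cast; ring_nf
        _ ≤ p (k * r₀) * p r₀ := hp _ _ (by positivity) hr₀.le
        _ ≤ p 0 * exp (s * r₀) ^ k * exp (s * r₀) := by gcongr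
        _ = p 0 * exp (s * r₀) ^ (k + 1) := by ring
  have hp0 : 0 < p 0 := by
    rw [Nat.cast_pos, Set.ncard_pos (finite_quotBall hPD o Γ _)]
    exact ⟨_, one_mem_quotBall o Γ (by linarith)⟩
  refine quotGrowthExp_le_of_ncard_le hPD (c := log (p 0) + s * (1 + r₀)) hs fun r hr => ?_
  set k := ⌈(r + 1) / r₀⌉₊
  have hk1 : r + 1 ≤ k * r₀ := (div_le_iff₀ hr₀).1 (Nat.le_ceil _)
  have hk2 : k * r₀ ≤ r + 1 + r₀ := by
    have := Nat.ceil_lt_add_one (a := (r + 1) / r₀) (by positivity)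
    have := mul_le_mul_of_nonneg_right this.le hr₀.le
    rwa [add_mul, div_mul_cancel₀ _ hr₀.ne', one_mul] at this
  calc ((quotBall o Γ (r + 1)).ncard : ℝ) ≤ p (k * r₀) := by
        rw [Nat.cast_le]
        exact Set.ncard_le_ncard (quotBall_mono o Γ (by linarith)) (finite_quotBall hPD o Γ _)
    _ ≤ p 0 * exp (s * r₀) ^ k := hpow k
    _ = exp (log (p 0) + s * (k * r₀)) := by
      rw [Real.exp_add, Real.exp_log hp0, ← Real.exp_nat_mul]
      ring_nf
    _ ≤ _ := by
      rw [Real.exp_le_exp]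
      linarith [mul_le_mul_of_nonneg_left hk2 hs]

theorem exists_ncard_quotBall_le_of_sum_le (hPD : ProperlyDiscontinuousAction G X) {o : X}
    {Γ : Subgroup G} {L : G ⧸ Γ → ℝ} {K δ M : ℝ} (hδ : 0 < δ)
    (hL : ∀ g : G, L g ≤ dist o (g • o) + K)
    (hM : ∀ S : Finset (G ⧸ Γ), ∑ q ∈ S, exp (-δ * L q) ≤ M) (C : ℝ) :
    ∃ r₀ s : ℝ, 0 < r₀ ∧ 0 ≤ s ∧ s < δ ∧ ((quotBall o Γ (r₀ + C)).ncard : ℝ) ≤ exp (s * r₀) := by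
  classical
  have hsum : Summable fun q => exp (-δ * L q) :=
    summable_of_sum_le (fun _ => (Real.exp_pos _).le) hM
  set η := exp (-δ * (C + K)) / 4 with hη
  have hη0 : 0 < η := by positivity
  obtain ⟨S, hS⟩ := hsum.vanishing (Metric.ball_mem_nhds 0 hη0)
  have hlim : Tendsto (fun r => exp (δ * r)) atTop atTop :=
    Real.tendsto_exp_atTop.comp (tendsto_id.const_mul_atTop hδ)
  obtain ⟨r, hrS, hr0, hrδ⟩ := ((hlim.eventually_ge_atTop (4 * (S.card : ℝ))).and
    ((eventually_gt_atTop 0).and (eventually_ge_atTop (log 2 / δ)))).exists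
  have hlog : 0 < log 2 := Real.log_pos one_lt_two
  refine ⟨r, δ - log 2 / r, hr0, ?_, by linarith [div_pos hlog hr0], ?_⟩
  · rw [sub_nonneg, div_le_iff₀ hr0, mul_comm]
    exact (div_le_iff₀ hδ).1 hrδ
  rw [sub_mul, div_mul_cancel₀ _ hr0.ne', Real.exp_sub, Real.exp_log two_pos]
  set B := (finite_quotBall hPD o Γ (r + C)).toFinset
  have hB : (quotBall o Γ (r + C)).ncard = B.card := Set.ncard_eq_toFinset_card _ _
  have hterm : ∀ q ∈ B \ S, exp (-δ * (r + C + K)) ≤ exp (-δ * L q) := by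
    intro q hq
    rw [Finset.mem_sdiff, Set.Finite.mem_toFinset] at hq
    obtain ⟨⟨g, hg, rfl⟩, -⟩ := hq
    have hg : dist o (g • o) ≤ r + C := hg
    rw [Real.exp_le_exp]
    have := mul_le_mul_of_nonneg_left ((hL g).trans (add_le_add_left hg K)) hδ.le
    linarith
  have h1 := Finset.card_nsmul_le_sum _ _ _ hterm
  have h2 := hS (B \ S) Finset.sdiff_disjoint
  rw [mem_ball_zero_iff, Real.norm_of_nonneg (Finset.sum_nonneg fun _ _ => (Real.exp_pos _).le)]
    at h2
  rw [nsmul_eq_mul] at h1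
  have h3 : ((B \ S).card : ℝ) ≤ exp (δ * r) / 4 := by
    have h4 : exp (-δ * (r + C + K)) = exp (-δ * (C + K)) / exp (δ * r) := by
      rw [← Real.exp_sub]
      ring_nf
    have h5 := h1.trans h2.le
    rw [h4, hη, mul_div_assoc', div_le_iff₀ (Real.exp_pos _)] at h5
    have h6 := Real.exp_pos (-δ * (C + K))
    refine le_of_mul_le_mul_right ?_ h6
    linarith
  have h4 : (B.card : ℝ) ≤ (B \ S).card + S.card := by
    exact_mod_cast Finset.card_le_card_sdiff_add_card
  rw [hB]
  linarith

end QuotientGrowth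

section Representatives

open Real (exp log)

theorem Finset.exists_separated_net {α : Type*} {d : α → α → ℝ} {D : ℝ}
    (hsymm : ∀ a b, d a b = d b a) (hself : ∀ a, d a a ≤ D) (A : Finset α) :
    ∃ T ⊆ A, (∀ b ∈ T, ∀ b' ∈ T, b ≠ b' → D < d b b') ∧ ∀ a ∈ A, ∃ t ∈ T, d a t ≤ D := by
  classical
  induction A using Finset.induction_on with
  | empty => exact ⟨∅, by simp⟩
  | insert a A _ ih =>
    obtain ⟨T, hTA, hsep, hnet⟩ := ih
    by_cases ha : ∃ t ∈ T, d a t ≤ D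
    · exact ⟨T, hTA.trans (Finset.subset_insert a A), hsep,
        (Finset.forall_mem_insert a A _).2 ⟨ha, hnet⟩⟩
    · push Not at ha
      refine ⟨insert a T, Finset.insert_subset_insert a hTA, ?_, ?_⟩
      · intro b hb b' hb' hne
        rcases Finset.mem_insert.1 hb with rfl | hbT <;>
          rcases Finset.mem_insert.1 hb' with rfl | hbT'
        · exact absurd rfl hne
        · exact ha b' hbT'
        · exact hsymm b' b ▸ ha b hbT
        · exact hsep b hbT b' hbT' hne
      · refine (Finset.forall_mem_insert a A _).2 ⟨⟨a, Finset.mem_insert_self a T, hself a⟩, ?_⟩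
        intro c hc
        obtain ⟨t, ht, hct⟩ := hnet c hc
        exact ⟨t, Finset.mem_insert_of_mem ht, hct⟩

variable {G X : Type*} [Group G] [MetricSpace X] [MulAction G X]

theorem exists_mk_eq_forall_dist_le (o : X) {Γ : Subgroup G} (q : G ⧸ Γ) :
    ∃ g : G, QuotientGroup.mk g = q ∧
      ∀ a : G, QuotientGroup.mk a = q → dist o (g • o) ≤ dist o (a • o) + 1 := by
  obtain ⟨g, hg, hmin⟩ := (measure fun g : G => ⌊dist o (g • o)⌋₊).wf.has_min
    {g : G | QuotientGroup.mk g = q} (QuotientGroup.mk_surjective q)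
  refine ⟨g, hg, fun a ha => ?_⟩
  have h1 : ⌊dist o (g • o)⌋₊ ≤ ⌊dist o (a • o)⌋₊ := not_lt.1 (hmin a ha)
  have h2 := Nat.lt_floor_add_one (dist o (g • o))
  have h3 := Nat.floor_le (dist_nonneg (x := o) (y := a • o))
  have h4 : (⌊dist o (g • o)⌋₊ : ℝ) ≤ ⌊dist o (a • o)⌋₊ := by exact_mod_cast h1
  linarith

/-- A Poincaré sum over a set of group elements is comparable to the one over a net. -/
theorem sum_exp_le_of_net [ProperSpace X] (hIso : IsometricAction G X)
    (hPD : ProperlyDiscontinuousAction G X) {o : X} {A T : Finset G} {D δ : ℝ} (hδ : 0 ≤ δ)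
    (hnet : ∀ a ∈ A, ∃ t ∈ T, dist (a • o) (t • o) ≤ D) :
    ∑ a ∈ A, exp (-δ * dist o (a • o)) ≤
      {g : G | dist o (g • o) ≤ D}.ncard * exp (δ * D) * ∑ t ∈ T, exp (-δ * dist o (t • o)) := by
  classical
  choose! f hfT hf using hnet
  rw [← Finset.sum_fiberwise_of_maps_to hfT, Finset.mul_sum]
  refine Finset.sum_le_sum fun t _ => ?_
  have hterm : ∀ a ∈ A.filter (fun a => f a = t), exp (-δ * dist o (a • o)) ≤
      exp (δ * D) * exp (-δ * dist o (t • o)) := by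
    intro a ha
    obtain ⟨haA, rfl⟩ := Finset.mem_filter.1 ha
    rw [← Real.exp_add, Real.exp_le_exp]
    have h1 := dist_triangle o (a • o) (f a • o)
    have h2 := mul_le_mul_of_nonneg_left (h1.trans (add_le_add_right (hf a haA) _)) hδ
    linarith
  refine (Finset.sum_le_card_nsmul _ _ _ hterm).trans ?_
  rw [nsmul_eq_mul, mul_assoc]
  gcongr
  rw [← Set.ncard_coe_finset, ← Set.ncard_image_of_injective _ (mul_right_injective t⁻¹)]
  refine Set.ncard_le_ncard ?_ (finite_setOf_dist_le hPD o D)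
  rintro _ ⟨a, ha, rfl⟩
  obtain ⟨haA, rfl⟩ := Finset.mem_filter.1 (Finset.mem_coe.1 ha)
  simp only [Set.mem_ofPred_eq]
  rw [mul_smul, ← hIso.dist_smul_left, dist_comm]
  exact hf a haA

namespace ContractingSystem

variable {o : X} {h : G} {P : G → X → X} {κ₀ κ : ℝ}

/-- Almost shortest coset representatives with bounded projections to the axis at both ends. -/
theorem exists_representatives (sys : ContractingSystem o h P κ₀ κ) (hIso : IsometricAction G X)
    {Γ : Subgroup G} [Γ.Normal] {γ : G} (hγΓ : γ ∈ Γ)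
    (hγ : ¬ HausdorffClose κ₀ (axis o h 1) (axis o h γ)) :
    ∃ rep : G ⧸ Γ → G, (∀ q, QuotientGroup.mk (rep q) = q) ∧
      (∀ g : G, dist o (rep g • o) ≤ dist o (g • o) + (1 + 2 * dist o (γ • o))) ∧
      (∀ q, dist o (P 1 (rep q • o)) ≤ 3 * κ + 2 * dist o (γ • o)) ∧
      ∀ q, dist o (P 1 ((rep q)⁻¹ • o)) ≤ 3 * κ + 2 * dist o (γ • o) := by
  have hκ := (sys.proj 1).nonneg
  have hℓ : 0 ≤ dist o (γ • o) := dist_nonneg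
  have hone : ∀ s : G, s = 1 ∨ s = γ⁻¹ → (s : G ⧸ Γ) = 1 ∧ dist o (s • o) ≤ dist o (γ • o) := by
    rintro s (rfl | rfl)
    · simp
    · exact ⟨(QuotientGroup.eq_one_iff _).2 (Γ.inv_mem hγΓ), (hIso.dist_inv_smul o γ).le⟩
  have key : ∀ q : G ⧸ Γ, ∃ a : G, QuotientGroup.mk a = q ∧
      (∀ g : G, QuotientGroup.mk g = q →
        dist o (a • o) ≤ dist o (g • o) + (1 + 2 * dist o (γ • o))) ∧
      dist o (P 1 (a • o)) ≤ 3 * κ + 2 * dist o (γ • o) ∧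
      dist o (P 1 (a⁻¹ • o)) ≤ 3 * κ + 2 * dist o (γ • o) := by
    intro q
    obtain ⟨a, haq, hamin⟩ := exists_mk_eq_forall_dist_le o q
    obtain ⟨s, hs, hsa⟩ := sys.exists_dist_proj_smul_le hγ hIso (a • o)
    obtain ⟨t, ht, hta⟩ := sys.exists_dist_proj_smul_le hγ hIso ((s * a)⁻¹ • o)
    obtain ⟨hs1, hsℓ⟩ := hone s hs
    obtain ⟨ht1, htℓ⟩ := hone t ht
    rw [← mul_smul] at hsa hta
    have htinv := hIso.dist_inv_smul o t
    refine ⟨s * a * t⁻¹, ?_, fun g hg => ?_, ?_, ?_⟩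
    · rw [QuotientGroup.mk_mul, QuotientGroup.mk_mul, QuotientGroup.mk_inv, hs1, ht1, haq]
      simp
    · linarith [hIso.dist_mul_smul_le o (s * a) t⁻¹, hIso.dist_mul_smul_le o s a, hamin g hg]
    · have h1 := (sys.proj 1).dist_proj_le ((s * a) • o) ((s * a * t⁻¹) • o)
      have h2 : dist ((s * a) • o) ((s * a * t⁻¹) • o) = dist o (t⁻¹ • o) := by
        rw [mul_smul (s * a), hIso]
      linarith [dist_triangle o (P 1 ((s * a) • o)) (P 1 ((s * a * t⁻¹) • o))]
    · rw [mul_inv_rev, inv_inv]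
      linarith
  choose rep hrep using key
  exact ⟨rep, fun q => (hrep q).1, fun g => (hrep _).2.1 g rfl, fun q => (hrep q).2.2.1,
    fun q => (hrep q).2.2.2⟩

/-- If the growth exponent of `G` is at most `δ`, then the Poincaré series of the quotient by an
infinite normal subgroup converges at `δ`. -/
theorem exists_sum_exp_quotient_le [ProperSpace X] (sys : ContractingSystem o h P κ₀ κ)
    (hIso : IsometricAction G X) (hPD : ProperlyDiscontinuousAction G X)
    (hSC : StronglyContractingElem o h) {Γ : Subgroup G} [hΓ : Γ.Normal] {γ : G} (hγΓ : γ ∈ Γ)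
    (hγ : ¬ HausdorffClose κ₀ (axis o h 1) (axis o h γ)) {δ : ℝ} (hδ : 0 ≤ δ)
    (hgr : growthExp o (Set.univ : Set G) ≤ ENNReal.ofReal δ) :
    ∃ (L : G ⧸ Γ → ℝ) (K M : ℝ), (∀ g : G, L g ≤ dist o (g • o) + K) ∧
      ∀ S : Finset (G ⧸ Γ), ∑ q ∈ S, exp (-δ * L q) ≤ M := by
  classical
  obtain ⟨rep, hmk, hmin, hproj, hproj_inv⟩ := sys.exists_representatives hIso hγΓ hγ
  have hκ := (sys.proj 1).nonneg
  set ℓ := dist o (γ • o) with hℓ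
  have hℓ0 : 0 ≤ ℓ := dist_nonneg
  set κ₁ := 3 * κ + 2 * ℓ with hκ₁
  set K := 1 + 2 * ℓ with hK
  obtain ⟨n, hn⟩ := exists_lt_dist_zpow hSC (K + 20 * κ + 20 * κ₁ + 20 * ℓ)
  specialize hn n (le_abs_self _)
  set F := h ^ (n : ℤ) * γ * h ^ (-(n : ℤ)) with hF
  have hF1 : (F : G ⧸ Γ) = 1 := (QuotientGroup.eq_one_iff _).2 (by
    rw [hF, zpow_neg]
    exact hΓ.conj_mem γ hγΓ _)
  set D := dist o (h ^ (n : ℤ) • o) + 10 * κ + 10 * κ₁ + 10 * ℓ with hD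
  have hD0 : 0 ≤ D := by positivity
  have hinj : Function.Injective rep := fun q q' hqq' => by rw [← hmk q, hqq', hmk]
  refine ⟨fun q => dist o (rep q • o), K, {g : G | dist o (g • o) ≤ 2 * κ₁ + κ}.ncard +
    {g : G | dist o (g • o) ≤ D}.ncard * exp (δ * D) * exp (δ * dist o (F • o)), hmin,
    fun S => ?_⟩
  rw [← Finset.sum_image (f := fun a : G => exp (-δ * dist o (a • o))) hinj.injOn,
    ← Finset.sum_filter_add_sum_filter_not _ fun a : G => dist o (a • o) ≤ 2 * κ₁ + κ]
  refine add_le_add ?_ ?_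
  · refine (Finset.sum_le_card_nsmul _ _ 1 fun a _ => ?_).trans ?_
    · rw [Real.exp_le_one_iff]
      nlinarith [dist_nonneg (x := o) (y := a • o)]
    · rw [nsmul_eq_mul, mul_one, Nat.cast_le, ← Set.ncard_coe_finset]
      refine Set.ncard_le_ncard (fun a ha => ?_) (finite_setOf_dist_le hPD o _)
      exact (Finset.mem_filter.1 (Finset.mem_coe.1 ha)).2
  · obtain ⟨T, hTA, hsep, hnet⟩ := Finset.exists_separated_net
      (d := fun a b : G => dist (a • o) (b • o)) (D := D) (fun _ _ => dist_comm _ _) (by simpa)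
      ((S.image rep).filter fun a => ¬ dist o (a • o) ≤ 2 * κ₁ + κ)
    refine (sum_exp_le_of_net hIso hPD hδ hnet).trans ?_
    gcongr
    have hT : ∀ b ∈ T, rep b = b ∧ 2 * κ₁ + κ < dist o (b • o) := fun b hb => by
      obtain ⟨hb1, hb2⟩ := Finset.mem_filter.1 (hTA hb)
      obtain ⟨q, -, rfl⟩ := Finset.mem_image.1 hb1
      exact ⟨by rw [hmk], not_le.1 hb2⟩
    have hsum := sys.sum_exp_le_one hIso hPD hγ (K := K) (κ₁ := κ₁) (n := n) (by positivity)
      (by positivity) hn (T := T) (fun b hb => ?_) hsep (fun b hb b' hb' => ?_) hδ hgr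
    · simp_rw [mul_add, Real.exp_add] at hsum
      rw [← Finset.sum_mul, neg_mul δ (dist o (F • o)), Real.exp_neg, ← div_eq_mul_inv,
        div_le_one (Real.exp_pos _)] at hsum
      exact hsum
    · obtain ⟨hbrep, hblong⟩ := hT b hb
      refine sys.isTransverse_of_lt hIso ?_ ?_ hblong
      · rw [← hbrep]
        exact hproj b
      · rw [← hbrep]
        exact hproj_inv b
    · obtain ⟨hbrep, -⟩ := hT b' hb'
      have h1 := hmin (b * F⁻¹ * b⁻¹ * b')
      have h2 : ((b * F⁻¹ * b⁻¹ * b' : G) : G ⧸ Γ) = b' := by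
        simp [QuotientGroup.mk_mul, QuotientGroup.mk_inv, hF1]
      rw [h2, hbrep] at h1
      have h3 : dist o ((b * F⁻¹ * b⁻¹ * b') • o) = dist ((b * F * b⁻¹) • o) (b' • o) := by
        rw [hIso.dist_smul_left, ← mul_smul]
        congr 2
        group
      have h4 := dist_triangle ((b * F * b⁻¹) • o) ((b * F) • o) (b' • o)
      have h5 : dist ((b * F * b⁻¹) • o) ((b * F) • o) = dist o (b • o) := by
        rw [mul_smul (b * F), hIso, dist_comm, hIso.dist_inv_smul]
      linarith

end ContractingSystem

end Representatives

/-- **Theorem (quasi-convex case).** If `G` is a finitely generated, non-elementary group,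
`X` is a quasi-convex `G`-space, and `G` contains a strongly contracting element, then
`G ↷ X` is a growth tight action. -/
theorem growth_tight_of_quasiConvex_of_stronglyContracting
    {G X : Type*} [Group G] [MetricSpace X] [MulAction G X] (o : X)
    (hFG : Group.FG G) (hNE : NonElementary G)
    (hProp : ProperSpace X) (hGeo : GeodesicSpace X)
    (hIso : IsometricAction G X) (hPD : ProperlyDiscontinuousAction G X)
    (hQC : QuasiConvexGSpace G o)
    (h : G) (hSC : StronglyContractingElem o h) :
    GrowthTight G o := by
  intro Γ hΓ hinf
  obtain ⟨P, κ₀, κ, sys⟩ := exists_contractingSystem hGeo hIso hPD hSC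
  obtain ⟨γ, hγΓ, hγ⟩ := sys.exists_mem_not_hausdorffClose hIso hPD hSC hNE hΓ hinf
  have hpos := sys.growthExp_pos hIso hPD hSC hγ
  obtain ⟨C, hC⟩ := exists_quotGrowthExp_le_of_ncard_le hIso hPD Γ hQC
  have htop : quotGrowthExp o Γ ≠ ⊤ := by
    set N := (quotBall o Γ (1 + C)).ncard
    refine ((hC 1 N one_pos (Nat.cast_nonneg N) ?_).trans_lt ENNReal.ofReal_lt_top).ne
    rw [mul_one]
    linarith [Real.add_one_le_exp (N : ℝ)]
  by_contra! hle
  have hδ : 0 < (quotGrowthExp o Γ).toReal := ENNReal.toReal_pos (hpos.trans_le hle).ne' htop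
  have hδeq := ENNReal.ofReal_toReal htop
  obtain ⟨L, K, M, hL, hM⟩ := sys.exists_sum_exp_quotient_le hIso hPD hSC hγΓ hγ hδ.le
    (hle.trans hδeq.ge)
  obtain ⟨r₀, s, hr₀, hs, hsδ, hcard⟩ := exists_ncard_quotBall_le_of_sum_le hPD hδ hL hM C
  have := (hC r₀ s hr₀ hs hcard).trans_lt ((ENNReal.ofReal_lt_ofReal_iff hδ).2 hsδ)
  rw [hδeq] at this
  exact lt_irrefl _ this
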